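/- arXiv:0801.1864 — 9 statements merged into one kernel-verified Lean document; each statement's English description precedes it below -/
import Mathlib

section
/- (Lemma 1(c)) There exists ε₁ with 0 < ε₁ < 1 such that for every n ≥ 1 and all z, z' ∈ Z, α_n(z,z')·q_n(z') ≥ ε₁·π(z'). In particular ε₁ = ω₁/K works, since q_n(z)/π(z) ≥ ω₁·g₀(z)/π(z) ≥ ω₁/K for all z. -/
theorem lemma1c {Z : Type*} [Countable Z] [DecidableEq Z]
    (π g₀ : Z → ℝ) (gbar : ℕ → Z → ℝ) (q : ℕ → Z → ℝ) (ω₁ K : ℝ)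
    (hπpos : ∀ z, 0 < π z) (hπsum : HasSum π 1)
    (hg₀pos : ∀ z, 0 < g₀ z) (hg₀sum : HasSum g₀ 1)
    (hgbarpos : ∀ n, 1 ≤ n → ∀ z, 0 ≤ gbar n z)
    (hgbarsum : ∀ n, 1 ≤ n → HasSum (gbar n) 1)
    (hω₁pos : 0 < ω₁) (hω₁lt : ω₁ < 1)
    (hq : ∀ n z, q n z = ω₁ * g₀ z + (1 - ω₁) * gbar n z)
    (hK : 1 ≤ K)
    (hdomπ : ∀ z, π z ≤ K * g₀ z)
    (hdomgbar : ∀ n, 1 ≤ n → ∀ z, gbar n z ≤ K * g₀ z)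
    (α : ℕ → Z → Z → ℝ)
    (hα : ∀ n z z', α n z z' = min 1 ((π z' / π z) * (q n z / q n z'))) :
    (∃ ε₁ : ℝ, 0 < ε₁ ∧ ε₁ < 1 ∧
      ∀ n, 1 ≤ n → ∀ z z', ε₁ * π z' ≤ α n z z' * q n z') ∧
    (∀ n, 1 ≤ n → ∀ z z', (ω₁ / K) * π z' ≤ α n z z' * q n z') := by
  have hK0 : 0 < K := one_pos.trans_le hK
  have hq_ge : ∀ n, 1 ≤ n → ∀ z, ω₁ / K * π z ≤ q n z := by
    intro n hn z
    have h₁ : ω₁ * π z ≤ ω₁ * (K * g₀ z) := mul_le_mul_of_nonneg_left (hdomπ z) hω₁pos.le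
    have h₂ : 0 ≤ (1 - ω₁) * gbar n z := mul_nonneg (sub_nonneg.2 hω₁lt.le) (hgbarpos n hn z)
    have h₃ : ω₁ / K * π z ≤ ω₁ * g₀ z := by
      rw [div_mul_eq_mul_div, div_le_iff₀ hK0]
      linarith
    rw [hq]
    linarith
  have hε : 0 < ω₁ / K := div_pos hω₁pos hK0
  have hmain : ∀ n, 1 ≤ n → ∀ z z', (ω₁ / K) * π z' ≤ α n z z' * q n z' := by
    intro n hn z z'
    have hqpos : 0 < q n z' := (mul_pos hε (hπpos z')).trans_le (hq_ge n hn z')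
    rw [hα, min_mul_of_nonneg _ _ hqpos.le, one_mul]
    refine le_min (hq_ge n hn z') ?_
    have h : π z' / π z * (q n z / q n z') * q n z' = q n z / π z * π z' := by
      field_simp
    rw [h]
    exact mul_le_mul_of_nonneg_right ((le_div_iff₀ (hπpos z)).2 (hq_ge n hn z)) (hπpos z').le
  exact ⟨⟨ω₁ / K, hε, (div_le_self hω₁pos.le hK).trans_lt hω₁lt, hmain⟩, hmain⟩
end

section
/- (Lemma 1(e)) Define Δ_n(z,z') = α_n(z,z')·q_n(z') − α_{n+1}(z,z')·q_{n+1}(z'). Then there is a constant K' > 0, independent of n, z, z', such that for all n ≥ 1 and all z, z' ∈ Z, |Δ_n(z,z')| ≤ K'·( g₀(z') + (π(z')/π(z))·g₀(z) )·a_n, where a_n = sup_{w∈Z} |ḡ_n(w) − ḡ_{n+1}(w)|/g₀(w). -/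
theorem min_one_mul_div_mul {r x y : ℝ} (hy : 0 < y) :
    min 1 (r * (x / y)) * y = min y (r * x) := by
  rw [min_mul_of_nonneg _ _ hy.le, one_mul, mul_assoc, div_mul_cancel₀ _ hy.ne']

theorem lemma1e {Z : Type*} [Countable Z] [DecidableEq Z]
    (π g₀ : Z → ℝ) (gbar : ℕ → Z → ℝ) (q : ℕ → Z → ℝ) (ω₁ K : ℝ)
    (hπpos : ∀ z, 0 < π z) (hπsum : HasSum π 1)
    (hg₀pos : ∀ z, 0 < g₀ z) (hg₀sum : HasSum g₀ 1)
    (hgbarpos : ∀ n, 1 ≤ n → ∀ z, 0 ≤ gbar n z)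
    (hgbarsum : ∀ n, 1 ≤ n → HasSum (gbar n) 1)
    (hω₁pos : 0 < ω₁) (hω₁lt : ω₁ < 1)
    (hq : ∀ n z, q n z = ω₁ * g₀ z + (1 - ω₁) * gbar n z)
    (hK : 1 ≤ K)
    (hdomπ : ∀ z, π z ≤ K * g₀ z)
    (hdomgbar : ∀ n, 1 ≤ n → ∀ z, gbar n z ≤ K * g₀ z)
    (α : ℕ → Z → Z → ℝ)
    (hα : ∀ n z z', α n z z' = min 1 ((π z' / π z) * (q n z / q n z')))
    (a : ℕ → ℝ)
    (habdd : ∀ n, 1 ≤ n → BddAbove (Set.range fun w => |gbar n w - gbar (n+1) w| / g₀ w))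
    (ha : ∀ n, 1 ≤ n → a n = ⨆ w, |gbar n w - gbar (n+1) w| / g₀ w) :
    ∃ K' : ℝ, 0 < K' ∧ ∀ n, 1 ≤ n → ∀ z z',
      |α n z z' * q n z' - α (n+1) z z' * q (n+1) z'| ≤
        K' * (g₀ z' + (π z' / π z) * g₀ z) * a n := by
  have hq_pos : ∀ n, 1 ≤ n → ∀ z, 0 < q n z := fun n hn z => by
    rw [hq]
    exact add_pos_of_pos_of_nonneg (mul_pos hω₁pos (hg₀pos z))
      (mul_nonneg (sub_nonneg.2 hω₁lt.le) (hgbarpos n hn z))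
  have hq_sub : ∀ n, 1 ≤ n → ∀ z, |q n z - q (n + 1) z| ≤ g₀ z * a n := fun n hn z => by
    have hgbar_sub : |gbar n z - gbar (n + 1) z| ≤ g₀ z * a n := by
      rw [← div_le_iff₀' (hg₀pos z), ha n hn]
      exact le_ciSup (habdd n hn) z
    have hq_eq : q n z - q (n + 1) z = (1 - ω₁) * (gbar n z - gbar (n + 1) z) := by
      rw [hq, hq]; ring
    rw [hq_eq, abs_mul, abs_of_pos (sub_pos.2 hω₁lt)]
    exact (mul_le_of_le_one_left (abs_nonneg _) (by linarith)).trans hgbar_sub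
  refine ⟨1, one_pos, fun n hn z z' => ?_⟩
  have hr : 0 < π z' / π z := div_pos (hπpos z') (hπpos z)
  rw [hα, hα, min_one_mul_div_mul (hq_pos n hn z'),
    min_one_mul_div_mul (hq_pos (n + 1) (by omega) z')]
  calc |min (q n z') (π z' / π z * q n z) - min (q (n + 1) z') (π z' / π z * q (n + 1) z)|
      ≤ max |q n z' - q (n + 1) z'| |π z' / π z * q n z - π z' / π z * q (n + 1) z| :=
        abs_min_sub_min_le_max _ _ _ _
    _ ≤ |q n z' - q (n + 1) z'| + |π z' / π z * q n z - π z' / π z * q (n + 1) z| :=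
        max_le_add_of_nonneg (abs_nonneg _) (abs_nonneg _)
    _ ≤ g₀ z' * a n + π z' / π z * (g₀ z * a n) := by
        rw [← mul_sub, abs_mul, abs_of_pos hr]
        gcongr
        · exact hq_sub n hn z'
        · exact hq_sub n hn z
    _ = 1 * (g₀ z' + π z' / π z * g₀ z) * a n := by ring
end

section
/- (Lemma 1(f)) There is a constant K' > 0, independent of n and z, such that for all n ≥ 1 and all z ∈ Z, |ν_n(z) − ν_{n+1}(z)| ≤ K'·(1 + g₀(z)/π(z))·a_n, where ν_n(z) = Σ_{z'∈Z} α_n(z,z')·q_n(z') and a_n = sup_{w∈Z} |ḡ_n(w) − ḡ_{n+1}(w)|/g₀(w). -/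
theorem lemma1f {Z : Type*} [Countable Z] [DecidableEq Z]
    (π g₀ : Z → ℝ) (gbar : ℕ → Z → ℝ) (q : ℕ → Z → ℝ) (ω₁ K : ℝ)
    (hπpos : ∀ z, 0 < π z) (hπsum : HasSum π 1)
    (hg₀pos : ∀ z, 0 < g₀ z) (hg₀sum : HasSum g₀ 1)
    (hgbarpos : ∀ n, 1 ≤ n → ∀ z, 0 ≤ gbar n z)
    (hgbarsum : ∀ n, 1 ≤ n → HasSum (gbar n) 1)
    (hω₁pos : 0 < ω₁) (hω₁lt : ω₁ < 1)
    (hq : ∀ n z, q n z = ω₁ * g₀ z + (1 - ω₁) * gbar n z)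
    (hK : 1 ≤ K)
    (hdomπ : ∀ z, π z ≤ K * g₀ z)
    (hdomgbar : ∀ n, 1 ≤ n → ∀ z, gbar n z ≤ K * g₀ z)
    (α : ℕ → Z → Z → ℝ)
    (hα : ∀ n z z', α n z z' = min 1 ((π z' / π z) * (q n z / q n z')))
    (ν : ℕ → Z → ℝ)
    (hν : ∀ n z, ν n z = ∑' z', α n z z' * q n z')
    (a : ℕ → ℝ)
    (habdd : ∀ n, 1 ≤ n → BddAbove (Set.range fun w => |gbar n w - gbar (n+1) w| / g₀ w))
    (ha : ∀ n, 1 ≤ n → a n = ⨆ w, |gbar n w - gbar (n+1) w| / g₀ w) :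
    ∃ K' : ℝ, 0 < K' ∧ ∀ n, 1 ≤ n → ∀ z,
      |ν n z - ν (n+1) z| ≤ K' * (1 + g₀ z / π z) * a n := by
  have gap : ∀ n, 1 ≤ n → ∀ w, |gbar n w - gbar (n+1) w| ≤ a n * g₀ w := by
    intro n hn w
    rw [← div_le_iff₀ (hg₀pos w), ha n hn]
    exact le_ciSup (habdd n hn) w
  have qpos : ∀ n, 1 ≤ n → ∀ w, 0 < q n w := by
    intro n hn w
    rw [hq]
    exact add_pos_of_pos_of_nonneg (mul_pos hω₁pos (hg₀pos w))
      (mul_nonneg (sub_nonneg.2 hω₁lt.le) (hgbarpos n hn w))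
  have qsum : ∀ n, 1 ≤ n → Summable (q n) := by
    intro n hn
    rw [show q n = fun w => ω₁ * g₀ w + (1 - ω₁) * gbar n w from funext (hq n)]
    exact (hg₀sum.summable.mul_left _).add ((hgbarsum n hn).summable.mul_left _)
  have qgap : ∀ n, 1 ≤ n → ∀ w, |q n w - q (n+1) w| ≤ a n * g₀ w := by
    intro n hn w
    rw [hq, hq, show ω₁ * g₀ w + (1 - ω₁) * gbar n w - (ω₁ * g₀ w + (1 - ω₁) * gbar (n+1) w)
      = (1 - ω₁) * (gbar n w - gbar (n+1) w) by ring, abs_mul, abs_of_pos (sub_pos.2 hω₁lt)]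
    exact (mul_le_of_le_one_left (abs_nonneg _) (by linarith)).trans (gap n hn w)
  have flow : ∀ n, 1 ≤ n → ∀ z w, α n z w * q n w = min (q n w) (π w / π z * q n z) := by
    intro n hn z w
    have hw := qpos n hn w
    rw [hα, min_mul_of_nonneg _ _ hw.le, one_mul, mul_assoc, div_mul_cancel₀ _ hw.ne']
  have flowsum : ∀ n, 1 ≤ n → ∀ z, Summable fun w => α n z w * q n w := by
    intro n hn z
    refine Summable.of_nonneg_of_le (fun w => ?_) (fun w => ?_) (qsum n hn)
    · rw [flow n hn]
      exact le_min (qpos n hn w).le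
        (mul_nonneg (div_pos (hπpos w) (hπpos z)).le (qpos n hn z).le)
    · rw [flow n hn]
      exact min_le_left _ _
  refine ⟨1, one_pos, fun n hn z => ?_⟩
  have hn' : 1 ≤ n + 1 := Nat.le_add_left 1 n
  rw [hν, hν, ← (flowsum n hn z).tsum_sub (flowsum (n+1) hn' z), ← Real.norm_eq_abs]
  have bound_sum : HasSum (fun w => a n * g₀ w + π w * (a n * g₀ z / π z))
      (1 * (1 + g₀ z / π z) * a n) := by
    rw [show 1 * (1 + g₀ z / π z) * a n = a n * 1 + 1 * (a n * g₀ z / π z) by ring]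
    exact (hg₀sum.mul_left (a n)).add (hπsum.mul_right (a n * g₀ z / π z))
  refine tsum_of_norm_bounded bound_sum fun w => ?_
  have hr : 0 < π w / π z := div_pos (hπpos w) (hπpos z)
  rw [Real.norm_eq_abs, flow n hn, flow (n+1) hn']
  calc
    _ ≤ max |q n w - q (n+1) w| |π w / π z * q n z - π w / π z * q (n+1) z| :=
      abs_min_sub_min_le_max _ _ _ _
    _ ≤ |q n w - q (n+1) w| + |π w / π z * q n z - π w / π z * q (n+1) z| :=
      max_le_add_of_nonneg (abs_nonneg _) (abs_nonneg _)
    _ ≤ a n * g₀ w + π w / π z * (a n * g₀ z) := by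
      rw [← mul_sub, abs_mul, abs_of_pos hr]
      exact add_le_add (qgap n hn w) (mul_le_mul_of_nonneg_left (qgap n hn z) hr.le)
    _ = a n * g₀ w + π w * (a n * g₀ z / π z) := by ring
end

section
/- (Lemma 2(b)) R_n is a transition kernel (R_n(z,z') ≥ 0 and Σ_{z'} R_n(z,z') = 1), and there exist a constant K' > 0 and a constant η ∈ (0,1), both independent of n, z, z', such that for all n ≥ 1 and all z, z' ∈ Z, R_n(z,z') ≤ K'·g₀(z') + η·δ_z(z'). -/
theorem lemma2b {Z : Type*} [Countable Z] [DecidableEq Z]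
    (π g₀ : Z → ℝ) (gbar : ℕ → Z → ℝ) (q : ℕ → Z → ℝ) (ω₁ K : ℝ)
    (hπpos : ∀ z, 0 < π z) (hπsum : HasSum π 1)
    (hg₀pos : ∀ z, 0 < g₀ z) (hg₀sum : HasSum g₀ 1)
    (hgbarpos : ∀ n, 1 ≤ n → ∀ z, 0 ≤ gbar n z)
    (hgbarsum : ∀ n, 1 ≤ n → HasSum (gbar n) 1)
    (hω₁pos : 0 < ω₁) (hω₁lt : ω₁ < 1)
    (hq : ∀ n z, q n z = ω₁ * g₀ z + (1 - ω₁) * gbar n z)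
    (hK : 1 ≤ K)
    (hdomπ : ∀ z, π z ≤ K * g₀ z)
    (hdomgbar : ∀ n, 1 ≤ n → ∀ z, gbar n z ≤ K * g₀ z)
    (α : ℕ → Z → Z → ℝ)
    (hα : ∀ n z z', α n z z' = min 1 ((π z' / π z) * (q n z / q n z')))
    (ν : ℕ → Z → ℝ)
    (hν : ∀ n z, ν n z = ∑' z', α n z z' * q n z')
    (T : ℕ → Z → Z → ℝ)
    (hT : ∀ n z z', T n z z' = α n z z' * q n z'
      + (if z' = z then (1:ℝ) else 0) * (1 - ν n z))
    (ε₁ : ℝ) (hε₁pos : 0 < ε₁) (hε₁lt : ε₁ < 1)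
    (hε₁min : ∀ n, 1 ≤ n → ∀ z z', ε₁ * π z' ≤ α n z z' * q n z')
    (ε : ℝ) (hεpos : 0 < ε) (hεlt : ε < ε₁)
    (R : ℕ → Z → Z → ℝ)
    (hR : ∀ n z z', R n z z' = (T n z z' - ε * π z') / (1 - ε)) :
    (∀ n, 1 ≤ n → ∀ z z', 0 ≤ R n z z') ∧
    (∀ n, 1 ≤ n → ∀ z, ∑' z', R n z z' = 1) ∧
    (∃ K' : ℝ, 0 < K' ∧ ∃ η : ℝ, 0 < η ∧ η < 1 ∧
      ∀ n, 1 ≤ n → ∀ z z',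
        R n z z' ≤ K' * g₀ z' + η * (if z' = z then (1:ℝ) else 0)) := by
  have hε1 : 0 < 1 - ε := by linarith
  have hωK : 0 ≤ (1 - ω₁) := by linarith
  have hqsum : ∀ n, 1 ≤ n → HasSum (q n) 1 := fun n hn => by
    have h := (hg₀sum.mul_left ω₁).add ((hgbarsum n hn).mul_left (1 - ω₁))
    have hqn : q n = fun z => ω₁ * g₀ z + (1 - ω₁) * gbar n z := funext (hq n)
    have hone : ω₁ * 1 + (1 - ω₁) * 1 = 1 := by ring
    rwa [hone, ← hqn] at h
  have hαq_le : ∀ n, 1 ≤ n → ∀ z z', α n z z' * q n z' ≤ q n z' := fun n hn z z' => by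
    have hq_nonneg : 0 ≤ q n z' := by
      rw [hq]
      exact add_nonneg (mul_nonneg hω₁pos.le (hg₀pos z').le)
        (mul_nonneg hωK (hgbarpos n hn z'))
    exact mul_le_of_le_one_left hq_nonneg (hα n z z' ▸ min_le_left _ _)
  have hq_le : ∀ n, 1 ≤ n → ∀ z, q n z ≤ K * g₀ z := fun n hn z => by
    rw [hq]
    nlinarith [mul_le_mul_of_nonneg_left (hdomgbar n hn z) hωK,
      mul_nonneg (mul_nonneg hω₁pos.le (hg₀pos z).le) (sub_nonneg.2 hK)]
  have hαq_nonneg : ∀ n, 1 ≤ n → ∀ z z', 0 ≤ α n z z' * q n z' := fun n hn z z' =>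
    (mul_nonneg hε₁pos.le (hπpos z').le).trans (hε₁min n hn z z')
  have hνsum : ∀ n, 1 ≤ n → ∀ z, HasSum (fun z' => α n z z' * q n z') (ν n z) :=
    fun n hn z => by
      rw [hν]
      exact (Summable.of_nonneg_of_le (hαq_nonneg n hn z) (hαq_le n hn z)
        (hqsum n hn).summable).hasSum
  have hν_le : ∀ n, 1 ≤ n → ∀ z, ν n z ≤ 1 := fun n hn z =>
    hasSum_le (hαq_le n hn z) (hνsum n hn z) (hqsum n hn)
  have hν_ge : ∀ n, 1 ≤ n → ∀ z, ε₁ ≤ ν n z := fun n hn z => by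
    simpa using hasSum_le (hε₁min n hn z) (hπsum.mul_left ε₁) (hνsum n hn z)
  refine ⟨fun n hn z z' => ?_, fun n hn z => ?_, K / (1 - ε), by positivity,
    (1 - ε₁) / (1 - ε), div_pos (by linarith) hε1, (div_lt_one hε1).2 (by linarith),
    fun n hn z z' => ?_⟩
  · rw [hR, hT]
    refine div_nonneg ?_ hε1.le
    have hδ : 0 ≤ (if z' = z then (1:ℝ) else 0) * (1 - ν n z) :=
      mul_nonneg (by split_ifs <;> norm_num) (sub_nonneg.2 (hν_le n hn z))
    linarith [hε₁min n hn z z', mul_le_mul_of_nonneg_right hεlt.le (hπpos z').le]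
  · have hδ : HasSum (fun z' => if z' = z then (1:ℝ) else 0) 1 := hasSum_ite_eq z 1
    have h := (((hνsum n hn z).add (hδ.mul_right (1 - ν n z))).sub
      (hπsum.mul_left ε)).div_const (1 - ε)
    have hone : (ν n z + 1 * (1 - ν n z) - ε * 1) / (1 - ε) = 1 := by
      rw [div_eq_one_iff_eq hε1.ne']
      ring
    simp only [hR, hT]
    exact h.tsum_eq.trans hone
  · rw [hR, hT, div_mul_eq_mul_div, div_mul_eq_mul_div, ← add_div]
    refine div_le_div_of_nonneg_right ?_ hε1.le
    have hδ : (if z' = z then (1:ℝ) else 0) * (1 - ν n z)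
        ≤ (1 - ε₁) * (if z' = z then (1:ℝ) else 0) := by
      have := hν_ge n hn z
      split_ifs <;> linarith
    linarith [hαq_le n hn z z', hq_le n hn z', mul_pos hεpos (hπpos z')]
end

section
/- (Lemma 2(d)) There exist a constant K' > 0 and η ∈ (0,1), independent of all indices and states, such that for every m ≥ 1, every n > m, and all states z_{n−m}, z_n ∈ Z, the m-step composition of residual kernels satisfies Σ_{z_{n−m+1}} ⋯ Σ_{z_{n−1}} ∏_{k=1}^{m} R_{n−k}(z_{n−k}, z_{n−k+1}) ≤ K'·g₀(z_n) + η^m·δ_{z_{n−m}}(z_n). -/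
/-- Averaging a nonnegative function, bounded by a constant plus a point mass, against a
probability mass function. -/
lemma tsum_mul_le_of_le_const_add_single {Z : Type*} [DecidableEq Z] {P f : Z → ℝ} {c d : ℝ}
    (hP0 : ∀ w, 0 ≤ P w) (hP : HasSum P 1) (z : Z) (hf0 : ∀ w, 0 ≤ f w)
    (hf : ∀ w, f w ≤ c + d * (if z = w then (1 : ℝ) else 0)) :
    ∑' w, P w * f w ≤ c + d * P z := by
  have hs : HasSum (fun w => c * P w + (if w = z then d * P z else 0)) (c * 1 + d * P z) :=
    (hP.mul_left c).add (hasSum_ite_eq z (d * P z))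
  have hle : ∀ w, P w * f w ≤ c * P w + (if w = z then d * P z else 0) := by
    intro w
    refine (mul_le_mul_of_nonneg_left (hf w) (hP0 w)).trans (le_of_eq ?_)
    by_cases h : w = z
    · subst h; simp; ring
    · simp [h, Ne.symm h]; ring
  have hsum := Summable.of_nonneg_of_le (fun w => mul_nonneg (hP0 w) (hf0 w)) hle hs.summable
  simpa using hasSum_le hle hsum.hasSum hs

/-- Iterating probability kernels dominated by `B * g z' + η * δ_z z'` gives kernels dominated by
the corresponding geometric sum. -/
lemma iterate_le_of_kernel_le {Z : Type*} [DecidableEq Z] {g : Z → ℝ} {B η : ℝ}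
    (hη0 : 0 ≤ η) (hη1 : η < 1) {R : ℕ → Z → Z → ℝ}
    (hR0 : ∀ n, 1 ≤ n → ∀ z z', 0 ≤ R n z z')
    (hR1 : ∀ n, 1 ≤ n → ∀ z, HasSum (R n z) 1)
    (hRle : ∀ n, 1 ≤ n → ∀ z z', R n z z' ≤ B * g z' + η * (if z' = z then (1 : ℝ) else 0))
    {M : ℕ → ℕ → Z → Z → ℝ}
    (hM0 : ∀ n z z', M n 0 z z' = (if z' = z then (1 : ℝ) else 0))
    (hMstep : ∀ n m z z', M n (m + 1) z z' = ∑' w, R (n - (m + 1)) z w * M n m w z')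
    {m n : ℕ} (hmn : m < n) (z z' : Z) :
    0 ≤ M n m z z' ∧ M n m z z' ≤
      B / (1 - η) * (1 - η ^ m) * g z' + η ^ m * (if z' = z then (1 : ℝ) else 0) := by
  induction m generalizing z with
  | zero => rw [hM0]; split_ifs <;> simp
  | succ m ih =>
    have hk : 1 ≤ n - (m + 1) := by omega
    have ih := ih (by omega)
    rw [hMstep]
    refine ⟨tsum_nonneg fun w => mul_nonneg (hR0 _ hk z w) (ih w).1, ?_⟩
    refine (tsum_mul_le_of_le_const_add_single (hR0 _ hk z) (hR1 _ hk z) z'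
      (fun w => (ih w).1) (fun w => (ih w).2)).trans ?_
    refine (add_le_add_right (mul_le_mul_of_nonneg_left (hRle _ hk z z')
      (pow_nonneg hη0 m)) _).trans (le_of_eq ?_)
    have : 1 - η ≠ 0 := by linarith
    field_simp
    ring

theorem lemma2d {Z : Type*} [Countable Z] [DecidableEq Z]
    (π g₀ : Z → ℝ) (gbar : ℕ → Z → ℝ) (q : ℕ → Z → ℝ) (ω₁ K : ℝ)
    (hπpos : ∀ z, 0 < π z) (hπsum : HasSum π 1)
    (hg₀pos : ∀ z, 0 < g₀ z) (hg₀sum : HasSum g₀ 1)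
    (hgbarpos : ∀ n, 1 ≤ n → ∀ z, 0 ≤ gbar n z)
    (hgbarsum : ∀ n, 1 ≤ n → HasSum (gbar n) 1)
    (hω₁pos : 0 < ω₁) (hω₁lt : ω₁ < 1)
    (hq : ∀ n z, q n z = ω₁ * g₀ z + (1 - ω₁) * gbar n z)
    (hK : 1 ≤ K)
    (hdomπ : ∀ z, π z ≤ K * g₀ z)
    (hdomgbar : ∀ n, 1 ≤ n → ∀ z, gbar n z ≤ K * g₀ z)
    (α : ℕ → Z → Z → ℝ)
    (hα : ∀ n z z', α n z z' = min 1 ((π z' / π z) * (q n z / q n z')))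
    (ν : ℕ → Z → ℝ)
    (hν : ∀ n z, ν n z = ∑' z', α n z z' * q n z')
    (T : ℕ → Z → Z → ℝ)
    (hT : ∀ n z z', T n z z' = α n z z' * q n z'
      + (if z' = z then (1:ℝ) else 0) * (1 - ν n z))
    (ε₁ : ℝ) (hε₁pos : 0 < ε₁) (hε₁lt : ε₁ < 1)
    (hε₁min : ∀ n, 1 ≤ n → ∀ z z', ε₁ * π z' ≤ α n z z' * q n z')
    (ε : ℝ) (hεpos : 0 < ε) (hεlt : ε < ε₁)
    (R : ℕ → Z → Z → ℝ)
    (hR : ∀ n z z', R n z z' = (T n z z' - ε * π z') / (1 - ε))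
    (M : ℕ → ℕ → Z → Z → ℝ)
    (hM0 : ∀ n z z', M n 0 z z' = (if z' = z then (1:ℝ) else 0))
    (hMstep : ∀ n m z z', M n (m+1) z z' = ∑' w, R (n - (m+1)) z w * M n m w z') :
    ∃ K' : ℝ, 0 < K' ∧ ∃ η : ℝ, 0 < η ∧ η < 1 ∧
      ∀ m n : ℕ, 1 ≤ m → m < n → ∀ z z',
        M n m z z' ≤ K' * g₀ z' + η ^ m * (if z' = z then (1:ℝ) else 0) := by
  have h1ε : 0 < 1 - ε := by linarith
  have hη1 : (1 - ε₁) / (1 - ε) < 1 := by rw [div_lt_one h1ε]; linarith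
  have hη0 : 0 < (1 - ε₁) / (1 - ε) := div_pos (by linarith) h1ε
  have hω : 0 < 1 - ω₁ := by linarith
  have hq0 : ∀ n, 1 ≤ n → ∀ z, 0 ≤ q n z := fun n hn z => by
    rw [hq]
    exact add_nonneg (mul_pos hω₁pos (hg₀pos z)).le (mul_nonneg hω.le (hgbarpos n hn z))
  have hqK : ∀ n, 1 ≤ n → ∀ z, q n z ≤ K * g₀ z := fun n hn z => by
    rw [hq]
    have h1 := mul_le_mul_of_nonneg_left (hdomgbar n hn z) hω.le
    have h2 := mul_le_mul_of_nonneg_left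
      (le_mul_of_one_le_left (hg₀pos z).le hK) hω₁pos.le
    linarith
  have hq1 : ∀ n, 1 ≤ n → HasSum (q n) 1 := fun n hn => by
    have h := (hg₀sum.mul_left ω₁).add ((hgbarsum n hn).mul_left (1 - ω₁))
    rw [show ω₁ * 1 + (1 - ω₁) * 1 = 1 by ring] at h
    rwa [funext (hq n)]
  have hαq : ∀ n, 1 ≤ n → ∀ z z', α n z z' * q n z' ≤ q n z' := fun n hn z z' =>
    mul_le_of_le_one_left (hq0 n hn z') (by rw [hα]; exact min_le_left _ _)
  have hνsum : ∀ n, 1 ≤ n → ∀ z, HasSum (fun z' => α n z z' * q n z') (ν n z) :=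
    fun n hn z => by
      rw [hν]
      exact (Summable.of_nonneg_of_le
        (fun z' => (mul_pos hε₁pos (hπpos z')).le.trans (hε₁min n hn z z'))
        (hαq n hn z) (hq1 n hn).summable).hasSum
  have hν1 : ∀ n, 1 ≤ n → ∀ z, ν n z ≤ 1 := fun n hn z =>
    hasSum_le (hαq n hn z) (hνsum n hn z) (hq1 n hn)
  have hνε : ∀ n, 1 ≤ n → ∀ z, ε₁ ≤ ν n z := fun n hn z => by
    simpa using hasSum_le (hε₁min n hn z) (hπsum.mul_left ε₁) (hνsum n hn z)
  have hR0 : ∀ n, 1 ≤ n → ∀ z z', 0 ≤ R n z z' := fun n hn z z' => by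
    rw [hR, hT]
    refine div_nonneg ?_ h1ε.le
    have h1 := hε₁min n hn z z'
    have h2 := mul_le_mul_of_nonneg_right hεlt.le (hπpos z').le
    have h3 : 0 ≤ (if z' = z then (1 : ℝ) else 0) * (1 - ν n z) :=
      mul_nonneg (by split_ifs <;> norm_num) (sub_nonneg.2 (hν1 n hn z))
    linarith
  have hR1 : ∀ n, 1 ≤ n → ∀ z, HasSum (R n z) 1 := fun n hn z => by
    have h := (((hνsum n hn z).add (hasSum_ite_eq z (1 - ν n z))).sub
      (hπsum.mul_left ε)).div_const (1 - ε)
    rw [show (ν n z + (1 - ν n z) - ε * 1) / (1 - ε) = 1 by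
      rw [div_eq_one_iff_eq h1ε.ne']; ring] at h
    have hRn : R n z = _ := funext (hR n z)
    simpa only [hRn, hT, ite_mul, one_mul, zero_mul] using h
  have hRle : ∀ n, 1 ≤ n → ∀ z z', R n z z' ≤
      K / (1 - ε) * g₀ z' + (1 - ε₁) / (1 - ε) * (if z' = z then (1 : ℝ) else 0) :=
    fun n hn z z' => by
      rw [hR, hT, div_mul_eq_mul_div, div_mul_eq_mul_div, ← add_div]
      refine div_le_div_of_nonneg_right ?_ h1ε.le
      have h1 := (hαq n hn z z').trans (hqK n hn z')
      have h2 := mul_pos hεpos (hπpos z')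
      have h3 := hνε n hn z
      split_ifs <;> linarith
  have hD : 0 < K / (1 - ε) / (1 - (1 - ε₁) / (1 - ε)) :=
    div_pos (div_pos (by linarith) h1ε) (by linarith)
  refine ⟨_, hD, _, hη0, hη1, fun m n _ hmn z z' => ?_⟩
  refine (iterate_le_of_kernel_le hη0.le hη1 hR0 hR1 hRle hM0 hMstep hmn z z').2.trans ?_
  refine add_le_add_left (mul_le_mul_of_nonneg_right ?_ (hg₀pos z').le) _
  exact mul_le_of_le_one_right hD.le (by linarith [pow_pos hη0 m])
end

section
/- (Intermediate claim in the proof of Theorem 1) Let q_I be a strictly positive probability mass function on Z with q_I(z) ≤ K·g₀(z) for all z. Then there is a constant K' > 0, independent of n, such that for every n ≥ 2 and every z_n ∈ Z, the n−1 step composition of residual kernels started from q_I satisfies Σ_{z_1} Σ_{z_2} ⋯ Σ_{z_{n−1}} q_I(z_1) ∏_{k=1}^{n−1} R_k(z_k, z_{k+1}) ≤ K'·g₀(z_n). -/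
/-- A Markov kernel with nonnegative entries pushes a probability mass function forward to a
probability mass function, and the sums defining the pushforward converge. -/
theorem hasSum_tsum_mul_of_stochastic {X Y : Type*} {p : X → ℝ} {S : X → Y → ℝ}
    (hp : ∀ x, 0 ≤ p x) (hpsum : HasSum p 1) (hS : ∀ x y, 0 ≤ S x y)
    (hSsum : ∀ x, HasSum (S x) 1) :
    (∀ y, Summable fun x => p x * S x y) ∧ HasSum (fun y => ∑' x, p x * S x y) 1 := by
  have hrow : ∀ x, HasSum (fun y => p x * S x y) (p x) := fun x => by
    simpa using (hSsum x).mul_left (p x)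
  have hsum : Summable fun a : X × Y => p a.1 * S a.1 a.2 := by
    refine (summable_prod_of_nonneg fun a => mul_nonneg (hp _) (hS _ _)).2
      ⟨fun x => (hrow x).summable, ?_⟩
    simpa only [(hrow _).tsum_eq] using hpsum.summable
  have htot : HasSum (fun a : X × Y => p a.1 * S a.1 a.2) 1 := by
    have h := hsum.hasSum.prod_fiberwise hrow
    rw [hpsum.unique h]
    exact hsum.hasSum
  have hswap : HasSum (fun a : Y × X => p a.2 * S a.2 a.1) 1 :=
    (Equiv.prodComm Y X).hasSum_iff.2 htot
  have hcol : ∀ y, Summable fun x => p x * S x y := fun y => hswap.summable.prod_factor y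
  exact ⟨hcol, hswap.prod_fiberwise fun y => (hcol y).hasSum⟩


theorem thm1_intermediate {Z : Type*} [Countable Z] [DecidableEq Z]
    (π g₀ : Z → ℝ) (gbar : ℕ → Z → ℝ) (q : ℕ → Z → ℝ) (ω₁ K : ℝ)
    (hπpos : ∀ z, 0 < π z) (hπsum : HasSum π 1)
    (hg₀pos : ∀ z, 0 < g₀ z) (hg₀sum : HasSum g₀ 1)
    (hgbarpos : ∀ n, 1 ≤ n → ∀ z, 0 ≤ gbar n z)
    (hgbarsum : ∀ n, 1 ≤ n → HasSum (gbar n) 1)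
    (hω₁pos : 0 < ω₁) (hω₁lt : ω₁ < 1)
    (hq : ∀ n z, q n z = ω₁ * g₀ z + (1 - ω₁) * gbar n z)
    (hK : 1 ≤ K)
    (hdomπ : ∀ z, π z ≤ K * g₀ z)
    (hdomgbar : ∀ n, 1 ≤ n → ∀ z, gbar n z ≤ K * g₀ z)
    (α : ℕ → Z → Z → ℝ)
    (hα : ∀ n z z', α n z z' = min 1 ((π z' / π z) * (q n z / q n z')))
    (ν : ℕ → Z → ℝ)
    (hν : ∀ n z, ν n z = ∑' z', α n z z' * q n z')
    (T : ℕ → Z → Z → ℝ)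
    (hT : ∀ n z z', T n z z' = α n z z' * q n z'
      + (if z' = z then (1:ℝ) else 0) * (1 - ν n z))
    (ε₁ : ℝ) (hε₁pos : 0 < ε₁) (hε₁lt : ε₁ < 1)
    (hε₁min : ∀ n, 1 ≤ n → ∀ z z', ε₁ * π z' ≤ α n z z' * q n z')
    (ε : ℝ) (hεpos : 0 < ε) (hεlt : ε < ε₁)
    (R : ℕ → Z → Z → ℝ)
    (hR : ∀ n z z', R n z z' = (T n z z' - ε * π z') / (1 - ε))
    (qI : Z → ℝ) (hqIpos : ∀ z, 0 < qI z) (hqIsum : HasSum qI 1)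
    (hdomI : ∀ z, qI z ≤ K * g₀ z)
    (ρ : ℕ → Z → ℝ) (hρ1 : ∀ z, ρ 1 z = qI z)
    (hρstep : ∀ k, 1 ≤ k → ∀ z', ρ (k+1) z' = ∑' z, ρ k z * R k z z') :
    ∃ K' : ℝ, 0 < K' ∧ ∀ n, 2 ≤ n → ∀ z, ρ n z ≤ K' * g₀ z := by
  have hqnonneg : ∀ n, 1 ≤ n → ∀ z, 0 ≤ q n z := fun n hn z => by
    rw [hq]
    have := mul_nonneg (sub_nonneg.2 hω₁lt.le) (hgbarpos n hn z)
    have := mul_pos hω₁pos (hg₀pos z)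
    linarith
  have hqsum : ∀ n, 1 ≤ n → HasSum (q n) 1 := fun n hn => by
    have h := (hg₀sum.mul_left ω₁).add ((hgbarsum n hn).mul_left (1 - ω₁))
    rw [show q n = _ from funext (hq n)]
    simpa using h
  have hqle : ∀ n, 1 ≤ n → ∀ z, q n z ≤ K * g₀ z := fun n hn z => by
    rw [hq]
    have h1 := mul_le_mul_of_nonneg_left (hdomgbar n hn z) (sub_nonneg.2 hω₁lt.le)
    have h2 := mul_le_mul_of_nonneg_left
      (le_mul_of_one_le_left (hg₀pos z).le hK) hω₁pos.le
    linarith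
  have hαq : ∀ n, 1 ≤ n → ∀ z z', α n z z' * q n z' ≤ q n z' := fun n hn z z' =>
    mul_le_of_le_one_left (hqnonneg n hn z') ((hα n z z').trans_le (min_le_left _ _))
  have hνsum : ∀ n, 1 ≤ n → ∀ z, HasSum (fun z' => α n z z' * q n z') (ν n z) :=
    fun n hn z => by
      rw [hν]
      exact (Summable.of_nonneg_of_le
        (fun z' => (mul_pos hε₁pos (hπpos z')).le.trans (hε₁min n hn z z'))
        (hαq n hn z) (hqsum n hn).summable).hasSum
  have hνle : ∀ n, 1 ≤ n → ∀ z, ν n z ≤ 1 := fun n hn z =>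
    hasSum_le (hαq n hn z) (hνsum n hn z) (hqsum n hn)
  have hνge : ∀ n, 1 ≤ n → ∀ z, ε₁ ≤ ν n z := fun n hn z => by
    simpa using hasSum_le (hε₁min n hn z) (hπsum.mul_left ε₁) (hνsum n hn z)
  have hε1 : 0 < 1 - ε := by linarith
  have hRnonneg : ∀ n, 1 ≤ n → ∀ z z', 0 ≤ R n z z' := fun n hn z z' => by
    rw [hR, hT]
    refine div_nonneg ?_ hε1.le
    have h1 := hε₁min n hn z z'
    have h2 := mul_le_mul_of_nonneg_right hεlt.le (hπpos z').le
    have h3 : 0 ≤ (if z' = z then (1 : ℝ) else 0) * (1 - ν n z) :=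
      mul_nonneg (by split_ifs <;> norm_num) (sub_nonneg.2 (hνle n hn z))
    linarith
  have hRsum : ∀ n, 1 ≤ n → ∀ z, HasSum (R n z) 1 := fun n hn z => by
    have h := (((hνsum n hn z).add ((hasSum_ite_eq z (1 : ℝ)).mul_right (1 - ν n z))).sub
      (hπsum.mul_left ε)).div_const (1 - ε)
    rw [show (ν n z + 1 * (1 - ν n z) - ε * 1) / (1 - ε) = 1 by field_simp; ring] at h
    rw [show R n z = _ from funext fun z' => (hR n z z').trans (by rw [hT])]
    exact h
  have hRle : ∀ n, 1 ≤ n → ∀ z z', R n z z' ≤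
      (K * g₀ z' + (if z = z' then 1 - ε₁ else 0)) / (1 - ε) := fun n hn z z' => by
    rw [hR, hT]
    refine div_le_div_of_nonneg_right ?_ hε1.le
    have h1 := (hαq n hn z z').trans (hqle n hn z')
    have h2 := mul_pos hεpos (hπpos z')
    have h3 := hνge n hn z
    by_cases h : z = z'
    · simp only [h, if_true] at *
      linarith
    · simp only [h, Ne.symm h, if_false]
      linarith
  have hεε : 0 < ε₁ - ε := sub_pos.2 hεlt
  have key : ∀ n, 1 ≤ n →
      (∀ z, 0 ≤ ρ n z) ∧ HasSum (ρ n) 1 ∧ ∀ z, ρ n z ≤ K / (ε₁ - ε) * g₀ z := by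
    intro n hn
    induction n, hn using Nat.le_induction with
    | base =>
      rw [show ρ 1 = qI from funext hρ1]
      refine ⟨fun z => (hqIpos z).le, hqIsum, fun z => (hdomI z).trans ?_⟩
      refine mul_le_mul_of_nonneg_right ?_ (hg₀pos z).le
      exact le_div_self (by linarith) hεε (by linarith)
    | succ n hn ih =>
      obtain ⟨hnonneg, hsum, hle⟩ := ih
      obtain ⟨hcol, htot⟩ :=
        hasSum_tsum_mul_of_stochastic hnonneg hsum (hRnonneg n hn) (hRsum n hn)
      rw [show ρ (n + 1) = _ from funext (hρstep n hn)]
      refine ⟨fun z' => tsum_nonneg fun z => mul_nonneg (hnonneg z) (hRnonneg n hn z z'),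
        htot, fun z' => ?_⟩
      have hbound : HasSum
          (fun z => ρ n z * ((K * g₀ z' + (if z = z' then 1 - ε₁ else 0)) / (1 - ε)))
          ((K * g₀ z' + ρ n z' * (1 - ε₁)) / (1 - ε)) := by
        have h := ((hsum.mul_right (K * g₀ z')).add
          (hasSum_ite_eq z' (ρ n z' * (1 - ε₁)))).div_const (1 - ε)
        rw [one_mul] at h
        refine h.congr_fun fun z => ?_
        by_cases hz : z = z'
        · simp only [hz, if_true]; ring
        · simp only [hz, if_false]; ring
      refine (hasSum_le (fun z => mul_le_mul_of_nonneg_left (hRle n hn z z') (hnonneg z))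
        (hcol z').hasSum hbound).trans ?_
      rw [div_le_iff₀ hε1]
      have h := mul_le_mul_of_nonneg_right (hle z') (sub_nonneg.2 hε₁lt.le)
      have hC : K / (ε₁ - ε) * (ε₁ - ε) = K := div_mul_cancel₀ _ hεε.ne'
      linear_combination h - g₀ z' * hC
  exact ⟨K / (ε₁ - ε), div_pos (by linarith) hεε, fun n hn => (key n (by lia)).2.2⟩
end

section
/- (Pointwise convergence bound, equation preceding the end of the proof of Theorem 1) Assume a_n ≤ C·n^{−r} for some C > 0 and r > 0, and let q_I be a strictly positive probability mass function with q_I(z) ≤ K·g₀(z) for all z. Let μ_n denote the distribution of the n-th state of the inhomogeneous Markov chain on Z with initial distribution q_I and one-step transition kernels T_1, T_2, …, i.e. μ_n(z_n) = Σ_{z_1,…,z_{n−1}} q_I(z_1) ∏_{k=1}^{n−1} T_k(z_k, z_{k+1}). Then there exist constants K' > 0 and r₁ > 0 such that for all n and all z ∈ Z, |μ_n(z) − π(z)| ≤ K'·g₀(z)·( (1−ε)^n + n^{−r₁} ), where ε ∈ (0, ε₁). -/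
/-- A nonnegative kernel whose rows all sum to `c` maps a summable function to a summable one,
multiplies its sum by `c`, and multiplies its `ℓ¹` norm by at most `c`. -/
lemma summable_kernel_apply {Z : Type*} {S : Z → Z → ℝ} {c : ℝ} {δ : Z → ℝ}
    (hS : ∀ z z', 0 ≤ S z z') (hrow : ∀ z, HasSum (S z) c) (hδ : Summable δ) :
    (∀ z', Summable fun z => δ z * S z z') ∧
    HasSum (fun z' => ∑' z, δ z * S z z') (c * ∑' z, δ z) ∧
    Summable (fun z' => |∑' z, δ z * S z z'|) ∧
    ∑' z', |∑' z, δ z * S z z'| ≤ c * ∑' z, |δ z| := by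
  have habsrow : ∀ z, HasSum (fun z' => |δ z * S z z'|) (|δ z| * c) := fun z => by
    simpa only [abs_mul, abs_of_nonneg (hS _ _)] using (hrow z).mul_left |δ z|
  have habs : Summable fun p : Z × Z => |δ p.1 * S p.1 p.2| := by
    rw [summable_prod_of_nonneg fun _ => abs_nonneg _]
    refine ⟨fun z => (habsrow z).summable, ?_⟩
    simp only [(habsrow _).tsum_eq]
    exact hδ.abs.mul_right c
  have hF : Summable fun p : Z × Z => δ p.1 * S p.1 p.2 := habs.of_abs
  have hcol : ∀ z', Summable fun z => δ z * S z z' := fun z' => hF.prod_symm.prod_factor z'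
  have hcols : Summable fun z' => ∑' z, |δ z * S z z'| := habs.prod_symm.prod
  have hle : ∀ z', |∑' z, δ z * S z z'| ≤ ∑' z, |δ z * S z z'| := fun z' =>
    norm_tsum_le_tsum_norm (f := fun z => δ z * S z z') (hcol z').abs
  have hsum : Summable fun z' => |∑' z, δ z * S z z'| :=
    Summable.of_nonneg_of_le (fun _ => abs_nonneg _) hle hcols
  refine ⟨hcol, ?_, hsum, ?_⟩
  · have h : ∑' z', ∑' z, δ z * S z z' = c * ∑' z, δ z := by
      rw [Summable.tsum_comm (f := fun z z' => δ z * S z z') hF, ← tsum_mul_left]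
      exact tsum_congr fun z => by rw [tsum_mul_left, (hrow z).tsum_eq, mul_comm]
    exact h ▸ hsum.of_abs.hasSum
  · calc ∑' z', |∑' z, δ z * S z z'| ≤ ∑' z', ∑' z, |δ z * S z z'| :=
          hsum.tsum_le_tsum hle hcols
      _ = ∑' z, ∑' z', |δ z * S z z'| :=
          Summable.tsum_comm (f := fun z z' => |δ z * S z z'|) habs
      _ = c * ∑' z, |δ z| := by
          rw [← tsum_mul_left]
          exact tsum_congr fun z => by rw [(habsrow z).tsum_eq, mul_comm]

/-- One step of a Metropolis–Hastings type chain whose off-diagonal part `P` is reversible with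
respect to `π`, dominated by an independent proposal `q`, and minorized by `ε₁ • π`. -/
lemma metropolis_step {Z : Type*} [DecidableEq Z] {π q μ μ' ν : Z → ℝ} {P T : Z → Z → ℝ} {ε₁ : ℝ}
    (hε₁ : 0 < ε₁) (hπpos : ∀ z, 0 < π z) (hπsum : HasSum π 1) (hqsum : HasSum q 1)
    (hPq : ∀ z z', P z z' ≤ q z') (hmin : ∀ z z', ε₁ * π z' ≤ P z z')
    (hrev : ∀ z z', π z * P z z' = π z' * P z' z)
    (hν : ∀ z, ν z = ∑' z', P z z')
    (hT : ∀ z z', T z z' = P z z' + (if z' = z then (1 : ℝ) else 0) * (1 - ν z))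
    (hμsum : HasSum μ 1) (hμ' : ∀ z', μ' z' = ∑' z, μ z * T z z') :
    HasSum μ' 1 ∧
    ∑' z, |μ' z - π z| ≤ (1 - ε₁) * ∑' z, |μ z - π z| ∧
    ∀ z, |μ' z - π z| ≤ q z * (∑' z, |μ z - π z|) + (1 - ε₁) * |μ z - π z| := by
  have hP0 : ∀ z z', 0 ≤ P z z' := fun z z' =>
    (mul_pos hε₁ (hπpos z')).le.trans (hmin z z')
  have hPsum : ∀ z, HasSum (P z) (ν z) := fun z => by
    rw [hν]
    exact (Summable.of_nonneg_of_le (hP0 z) (hPq z) hqsum.summable).hasSum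
  have hν1 : ∀ z, ν z ≤ 1 := fun z => hasSum_le (hPq z) (hPsum z) hqsum
  have hνε : ∀ z, ε₁ ≤ ν z := fun z => by
    simpa using hasSum_le (hmin z) (hπsum.mul_left ε₁) (hPsum z)
  have hdiag : ∀ z, HasSum (fun z' => (if z' = z then (1 : ℝ) else 0) * (1 - ν z)) (1 - ν z) :=
    fun z => by simpa using (hasSum_ite_eq z (1 : ℝ)).mul_right (1 - ν z)
  have hTrow : ∀ z, HasSum (T z) 1 := fun z => by
    have h := (hPsum z).add (hdiag z)
    rw [add_sub_cancel] at h
    rwa [show T z = _ from funext (hT z)]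
  have hSrow : ∀ z, HasSum (fun z' => T z z' - ε₁ * π z') (1 - ε₁) := fun z => by
    simpa using (hTrow z).sub (hπsum.mul_left ε₁)
  have hS0 : ∀ z z', 0 ≤ T z z' - ε₁ * π z' := fun z z' => by
    have h1 := hmin z z'
    have h2 := hν1 z
    rw [hT]
    split_ifs <;> linarith
  have hT0 : ∀ z z', 0 ≤ T z z' := fun z z' => by
    have := hS0 z z'
    have := mul_pos hε₁ (hπpos z')
    linarith
  have hdiagcol : ∀ (f : Z → ℝ) (z' : Z),
      HasSum (fun z => f z * ((if z' = z then (1 : ℝ) else 0) * (1 - ν z)))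
        (f z' * (1 - ν z')) := fun f z' => by
    convert hasSum_single z' ?_ using 1
    · simp
    · intro z hz
      simp [hz.symm]
  have hπinv : ∀ z', HasSum (fun z => π z * T z z') (π z') := fun z' => by
    have h := ((hPsum z').mul_left (π z')).add (hdiagcol π z')
    rw [← mul_add, add_sub_cancel, mul_one] at h
    simpa only [hT, mul_add, hrev _ z'] using h
  have hδ : HasSum (fun z => μ z - π z) 0 := by simpa using hμsum.sub hπsum
  have hμcol := (summable_kernel_apply hT0 hTrow hμsum.summable).1
  obtain ⟨hScol, hSsum, -, hSnorm⟩ := summable_kernel_apply hS0 hSrow hδ.summable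
  have hδ' : ∀ z', HasSum (fun z => (μ z - π z) * T z z') (μ' z' - π z') := fun z' => by
    rw [hμ']
    simpa only [sub_mul] using (hμcol z').hasSum.sub (hπinv z')
  have hstep : ∀ z', ∑' z, (μ z - π z) * (T z z' - ε₁ * π z') = μ' z' - π z' := fun z' => by
    have h := (hδ' z').sub (hδ.mul_right (ε₁ * π z'))
    rw [zero_mul, sub_zero] at h
    simpa only [mul_sub] using h.tsum_eq
  simp only [hstep, hδ.tsum_eq, mul_zero] at hSsum hSnorm
  refine ⟨by simpa using hSsum.add hπsum, hSnorm, fun z' => ?_⟩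
  have hPcol : HasSum (fun z => (μ z - π z) * P z z')
      (μ' z' - π z' - (μ z' - π z') * (1 - ν z')) := by
    have h := (hδ' z').sub (hdiagcol (fun z => μ z - π z) z')
    simpa only [← mul_sub, hT, add_sub_cancel_right] using h
  have hbound : |μ' z' - π z' - (μ z' - π z') * (1 - ν z')| ≤ q z' * ∑' z, |μ z - π z| := by
    rw [← hPcol.tsum_eq, ← tsum_mul_left, ← Real.norm_eq_abs]
    refine tsum_of_norm_bounded (hδ.summable.abs.mul_left (q z')).hasSum fun z => ?_
    rw [Real.norm_eq_abs, abs_mul, abs_of_nonneg (hP0 _ _), mul_comm]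
    exact mul_le_mul_of_nonneg_right (hPq _ _) (abs_nonneg _)
  have hdiagle : |(μ z' - π z') * (1 - ν z')| ≤ (1 - ε₁) * |μ z' - π z'| := by
    rw [abs_mul, abs_of_nonneg (sub_nonneg.2 (hν1 z')), mul_comm]
    exact mul_le_mul_of_nonneg_right (by linarith [hνε z']) (abs_nonneg _)
  have := abs_add_le (μ' z' - π z' - (μ z' - π z') * (1 - ν z')) ((μ z' - π z') * (1 - ν z'))
  rw [sub_add_cancel] at this
  linarith


theorem thm1_pointwise {Z : Type*} [Countable Z] [DecidableEq Z]
    (π g₀ : Z → ℝ) (gbar : ℕ → Z → ℝ) (q : ℕ → Z → ℝ) (ω₁ K : ℝ)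
    (hπpos : ∀ z, 0 < π z) (hπsum : HasSum π 1)
    (hg₀pos : ∀ z, 0 < g₀ z) (hg₀sum : HasSum g₀ 1)
    (hgbarpos : ∀ n, 1 ≤ n → ∀ z, 0 ≤ gbar n z)
    (hgbarsum : ∀ n, 1 ≤ n → HasSum (gbar n) 1)
    (hω₁pos : 0 < ω₁) (hω₁lt : ω₁ < 1)
    (hq : ∀ n z, q n z = ω₁ * g₀ z + (1 - ω₁) * gbar n z)
    (hK : 1 ≤ K)
    (hdomπ : ∀ z, π z ≤ K * g₀ z)
    (hdomgbar : ∀ n, 1 ≤ n → ∀ z, gbar n z ≤ K * g₀ z)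
    (α : ℕ → Z → Z → ℝ)
    (hα : ∀ n z z', α n z z' = min 1 ((π z' / π z) * (q n z / q n z')))
    (ν : ℕ → Z → ℝ)
    (hν : ∀ n z, ν n z = ∑' z', α n z z' * q n z')
    (T : ℕ → Z → Z → ℝ)
    (hT : ∀ n z z', T n z z' = α n z z' * q n z'
      + (if z' = z then (1:ℝ) else 0) * (1 - ν n z))
    (ε₁ : ℝ) (hε₁pos : 0 < ε₁) (hε₁lt : ε₁ < 1)
    (hε₁min : ∀ n, 1 ≤ n → ∀ z z', ε₁ * π z' ≤ α n z z' * q n z')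
    (ε : ℝ) (hεpos : 0 < ε) (hεlt : ε < ε₁)
    (R : ℕ → Z → Z → ℝ)
    (hR : ∀ n z z', R n z z' = (T n z z' - ε * π z') / (1 - ε))
    (a : ℕ → ℝ)
    (habdd : ∀ n, 1 ≤ n → BddAbove (Set.range fun w => |gbar n w - gbar (n+1) w| / g₀ w))
    (ha : ∀ n, 1 ≤ n → a n = ⨆ w, |gbar n w - gbar (n+1) w| / g₀ w)
    (C r : ℝ) (hC : 0 < C) (hr : 0 < r)
    (hdecay : ∀ n, 1 ≤ n → a n ≤ C * (n : ℝ) ^ (-r))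
    (qI : Z → ℝ) (hqIpos : ∀ z, 0 < qI z) (hqIsum : HasSum qI 1)
    (hdomI : ∀ z, qI z ≤ K * g₀ z)
    (μ : ℕ → Z → ℝ) (hμ1 : ∀ z, μ 1 z = qI z)
    (hμstep : ∀ k, 1 ≤ k → ∀ z', μ (k+1) z' = ∑' z, μ k z * T k z z') :
    ∃ K' : ℝ, 0 < K' ∧ ∃ r₁ : ℝ, 0 < r₁ ∧ ∀ n, 1 ≤ n → ∀ z,
      |μ n z - π z| ≤ K' * g₀ z * ((1 - ε) ^ n + (n : ℝ) ^ (-r₁)) := by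
  have hω : 0 ≤ 1 - ω₁ := by linarith
  have hqpos : ∀ n, 1 ≤ n → ∀ z, 0 < q n z := fun n hn z => by
    rw [hq]
    exact add_pos_of_pos_of_nonneg (mul_pos hω₁pos (hg₀pos z)) (mul_nonneg hω (hgbarpos n hn z))
  have hqsum : ∀ n, 1 ≤ n → HasSum (q n) 1 := fun n hn => by
    have h := (hg₀sum.mul_left ω₁).add ((hgbarsum n hn).mul_left (1 - ω₁))
    rw [show q n = _ from funext (hq n)]
    simpa using h
  have hqle : ∀ n, 1 ≤ n → ∀ z, q n z ≤ K * g₀ z := fun n hn z => by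
    rw [hq]
    have h1 : g₀ z ≤ K * g₀ z := le_mul_of_one_le_left (hg₀pos z).le hK
    have h2 := mul_le_mul_of_nonneg_left h1 hω₁pos.le
    have h3 := mul_le_mul_of_nonneg_left (hdomgbar n hn z) hω
    linarith
  have hPq : ∀ n, 1 ≤ n → ∀ z z', α n z z' * q n z' ≤ q n z' := fun n hn z z' => by
    refine mul_le_of_le_one_left (hqpos n hn z').le ?_
    rw [hα]
    exact min_le_left _ _
  have hflow : ∀ n, 1 ≤ n → ∀ z z',
      π z * (α n z z' * q n z') = min (π z * q n z') (π z' * q n z) := fun n hn z z' => by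
    have h1 := hπpos z
    have h2 := hqpos n hn z'
    rw [hα, mul_left_comm, mul_comm, mul_min_of_nonneg _ _ (by positivity), mul_one]
    congr 1
    field_simp
  have hrev : ∀ n, 1 ≤ n → ∀ z z',
      π z * (α n z z' * q n z') = π z' * (α n z' z * q n z) := fun n hn z z' => by
    rw [hflow n hn, hflow n hn, min_comm]
  have hstep := fun n (hn : 1 ≤ n) (hμsum : HasSum (μ n) 1) =>
    metropolis_step hε₁pos hπpos hπsum (hqsum n hn) (hPq n hn) (hε₁min n hn) (hrev n hn)
      (hν n) (hT n) hμsum (hμstep n hn)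
  have hρ : 0 < 1 - ε := by linarith
  have hgap : 0 < ε₁ - ε := by linarith
  have hμ1' : μ 1 = qI := funext hμ1
  have hl1 : ∀ m : ℕ, HasSum (μ (m + 1)) 1 ∧ ∑' z, |μ (m + 1) z - π z| ≤ 2 * (1 - ε) ^ m := by
    intro m
    induction m with
    | zero =>
      rw [zero_add, hμ1']
      refine ⟨hqIsum, ?_⟩
      have h := hqIsum.add hπsum
      rw [pow_zero, mul_one, ← one_add_one_eq_two, ← h.tsum_eq]
      refine (hqIsum.summable.sub hπsum.summable).abs.tsum_le_tsum (fun z => ?_) h.summable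
      rw [abs_le]
      constructor <;> linarith [hqIpos z, hπpos z]
    | succ m ih =>
      obtain ⟨h1, h2, -⟩ := hstep (m + 1) (by omega) ih.1
      refine ⟨h1, h2.trans ?_⟩
      calc (1 - ε₁) * ∑' z, |μ (m + 1) z - π z| ≤ (1 - ε) * (2 * (1 - ε) ^ m) :=
            mul_le_mul (by linarith) ih.2 (tsum_nonneg fun _ => abs_nonneg _) hρ.le
        _ = 2 * (1 - ε) ^ (m + 1) := by ring
  have hKpos : 0 < K := by linarith
  have hpt : ∀ m : ℕ, ∀ z,
      |μ (m + 1) z - π z| ≤ 2 * K / (ε₁ - ε) * g₀ z * (1 - ε) ^ m := by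
    intro m z
    have hg := hg₀pos z
    induction m with
    | zero =>
      have h1 : K ≤ 2 * K / (ε₁ - ε) := by
        rw [le_div_iff₀ hgap]
        nlinarith
      have h2 := mul_le_mul_of_nonneg_right h1 hg.le
      rw [zero_add, hμ1', pow_zero, mul_one, abs_le]
      constructor <;> linarith [hqIpos z, hπpos z, hdomI z, hdomπ z]
    | succ m ih =>
      have h := (hstep (m + 1) (by omega) (hl1 m).1).2.2 z
      calc |μ (m + 1 + 1) z - π z|
          ≤ q (m + 1) z * (∑' z, |μ (m + 1) z - π z|) + (1 - ε₁) * |μ (m + 1) z - π z| := h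
        _ ≤ K * g₀ z * (2 * (1 - ε) ^ m)
            + (1 - ε₁) * (2 * K / (ε₁ - ε) * g₀ z * (1 - ε) ^ m) :=
          add_le_add
            (mul_le_mul (hqle _ (by omega) z) (hl1 m).2 (tsum_nonneg fun _ => abs_nonneg _)
              (by positivity))
            (mul_le_mul_of_nonneg_left ih (by linarith))
        _ = 2 * K / (ε₁ - ε) * g₀ z * (1 - ε) ^ (m + 1) := by
          field_simp
          ring
  refine ⟨2 * K / (ε₁ - ε) / (1 - ε), by positivity, 1, one_pos, fun n hn z => ?_⟩
  obtain ⟨m, rfl⟩ : ∃ m, n = m + 1 := ⟨n - 1, by omega⟩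
  have hg := hg₀pos z
  calc |μ (m + 1) z - π z| ≤ 2 * K / (ε₁ - ε) * g₀ z * (1 - ε) ^ m := hpt m z
    _ = 2 * K / (ε₁ - ε) / (1 - ε) * g₀ z * (1 - ε) ^ (m + 1) := by
      field_simp
      ring
    _ ≤ _ := mul_le_mul_of_nonneg_left (le_add_of_nonneg_right (by positivity)) (by positivity)
end

section
/- (Theorem 1) Assume a_n ≤ C·n^{−r} for some C > 0 and r > 0, and let q_I be a strictly positive probability mass function with q_I(z) ≤ K·g₀(z) for all z. Let μ_n denote the distribution of the n-th state of the inhomogeneous Markov chain on Z with initial distribution q_I and one-step transition kernels T_1, T_2, …, i.e. μ_n(z_n) = Σ_{z_1,…,z_{n−1}} q_I(z_1) ∏_{k=1}^{n−1} T_k(z_k, z_{k+1}). Then the chain converges to the target in total variation: sup_{A ⊆ Z} |μ_n(A) − π(A)| → 0 as n → ∞, where μ_n(A) = Σ_{z∈A} μ_n(z) and π(A) = Σ_{z∈A} π(z). -/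
/-- A nonnegative kernel on a countable space applied to a summable function. -/
theorem summable_mul_kernel {Z : Type*} {P : Z → Z → ℝ} {s : ℝ}
    (hP : ∀ z w, 0 ≤ P z w) (hPs : ∀ z, HasSum (P z) s)
    {f : Z → ℝ} (hf : Summable f) :
    Summable (fun p : Z × Z => f p.1 * P p.1 p.2) := by
  rw [← summable_norm_iff, summable_prod_of_nonneg (fun p => norm_nonneg _)]
  have key : ∀ z, HasSum (fun w => ‖f z * P z w‖) (|f z| * s) := fun z => by
    simpa only [Real.norm_eq_abs, abs_mul, abs_of_nonneg (hP z _)] using (hPs z).mul_left |f z|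
  refine ⟨fun z => (key z).summable, ?_⟩
  simp only [(key _).tsum_eq]
  exact hf.abs.mul_right s

/-- A kernel with constant row sum `s` multiplies total mass by `s`. -/
theorem hasSum_tsum_mul_kernel {Z : Type*} {P : Z → Z → ℝ} {s : ℝ}
    (hP : ∀ z w, 0 ≤ P z w) (hPs : ∀ z, HasSum (P z) s)
    {f : Z → ℝ} (hf : Summable f) :
    HasSum (fun w => ∑' z, f z * P z w) ((∑' z, f z) * s) := by
  have h := summable_mul_kernel hP hPs hf
  have hswap : Summable (fun p : Z × Z => f p.2 * P p.2 p.1) := h.prod_symm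
  have h1 : Summable (fun w => ∑' z, f z * P z w) := hswap.prod
  have h2 : ∑' w, ∑' z, f z * P z w = (∑' z, f z) * s := by
    rw [Summable.tsum_comm (f := fun z w => f z * P z w) h]
    simp only [tsum_mul_left, (hPs _).tsum_eq, tsum_mul_right]
  exact h2 ▸ h1.hasSum

/-- A nonnegative kernel with constant row sum `s` is `s`-Lipschitz for the `ℓ¹` norm. -/
theorem tsum_abs_tsum_mul_kernel_le {Z : Type*} {P : Z → Z → ℝ} {s : ℝ}
    (hP : ∀ z w, 0 ≤ P z w) (hPs : ∀ z, HasSum (P z) s)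
    {f : Z → ℝ} (hf : Summable f) :
    ∑' w, |∑' z, f z * P z w| ≤ (∑' z, |f z|) * s := by
  have h := hasSum_tsum_mul_kernel hP hPs hf.abs
  have hle : ∀ w, |∑' z, f z * P z w| ≤ ∑' z, |f z| * P z w := fun w => by
    have hs : Summable (fun z => |f z| * P z w) :=
      (summable_mul_kernel hP hPs hf.abs).prod_symm.prod_factor w
    have hs' : Summable (fun z => ‖f z * P z w‖) := by
      simpa only [Real.norm_eq_abs, abs_mul, abs_of_nonneg (hP _ w)] using hs
    simpa only [Real.norm_eq_abs, abs_mul, abs_of_nonneg (hP _ w)] using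
      norm_tsum_le_tsum_norm hs'
  rw [← h.tsum_eq]
  exact (hasSum_tsum_mul_kernel hP hPs hf).summable.abs.tsum_le_tsum hle h.summable

/-- Doeblin contraction: a Markov kernel minorized by `β` times its invariant law `π` contracts
the `ℓ¹` distance to `π` by the factor `1 - β`. -/
theorem tsum_abs_sub_invariant_le {Z : Type*} {P : Z → Z → ℝ} {π μ : Z → ℝ} {β : ℝ}
    (hP : ∀ z w, 0 ≤ P z w) (hPs : ∀ z, HasSum (P z) 1)
    (hπ : HasSum π 1) (hμ : HasSum μ 1)
    (hinv : ∀ w, ∑' z, π z * P z w = π w) (hmin : ∀ z w, β * π w ≤ P z w) :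
    ∑' w, |(∑' z, μ z * P z w) - π w| ≤ (∑' z, |μ z - π z|) * (1 - β) := by
  have hd : HasSum (fun z => μ z - π z) 0 := by simpa using hμ.sub hπ
  have hR : ∀ z, HasSum (fun w => P z w - β * π w) (1 - β) := fun z => by
    simpa using (hPs z).sub (hπ.mul_left β)
  refine le_of_eq_of_le (tsum_congr fun w => ?_)
    (tsum_abs_tsum_mul_kernel_le (fun z w => sub_nonneg.2 (hmin z w)) hR hd.summable)
  have col : ∀ {f : Z → ℝ}, Summable f → Summable (fun z => f z * P z w) := fun hf =>
    (summable_mul_kernel hP hPs hf).prod_symm.prod_factor w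
  have h : HasSum (fun z => (μ z - π z) * (P z w - β * π w))
      ((∑' z, μ z * P z w) - π w) := by
    have h1 := ((col hμ.summable).hasSum.sub (col hπ.summable).hasSum).sub
      (hd.mul_right (β * π w))
    rw [hinv, zero_mul, sub_zero] at h1
    rw [show (fun z => (μ z - π z) * (P z w - β * π w)) = fun z =>
      μ z * P z w - π z * P z w - (μ z - π z) * (β * π w) from funext fun z => by ring]
    exact h1
  rw [h.tsum_eq]

/-- The supremum over events of the difference of masses is at most the `ℓ¹` distance. -/
theorem iSup_abs_tsum_sub_le {Z : Type*} {μ π : Z → ℝ} (hμ : Summable μ) (hπ : Summable π) :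
    ⨆ A : Set Z, |(∑' z : A, μ (z : Z)) - ∑' z : A, π (z : Z)| ≤ ∑' z, |μ z - π z| := by
  refine ciSup_le fun A => ?_
  have hd := (hμ.sub hπ).abs
  rw [show (∑' z : A, μ z) - ∑' z : A, π z = ∑' z : A, (μ z - π z) from
    ((hμ.subtype A).tsum_sub (hπ.subtype A)).symm]
  calc |∑' z : A, (μ z - π z)| ≤ ∑' z : A, |μ z - π z| := by
        simpa only [Real.norm_eq_abs] using
          norm_tsum_le_tsum_norm (f := fun z : A => μ z - π z) (hd.subtype A)
    _ ≤ ∑' z, |μ z - π z| := hd.tsum_subtype_le _ A (fun z => abs_nonneg _)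


theorem thm1 {Z : Type*} [Countable Z] [DecidableEq Z]
    (π g₀ : Z → ℝ) (gbar : ℕ → Z → ℝ) (q : ℕ → Z → ℝ) (ω₁ K : ℝ)
    (hπpos : ∀ z, 0 < π z) (hπsum : HasSum π 1)
    (hg₀pos : ∀ z, 0 < g₀ z) (hg₀sum : HasSum g₀ 1)
    (hgbarpos : ∀ n, 1 ≤ n → ∀ z, 0 ≤ gbar n z)
    (hgbarsum : ∀ n, 1 ≤ n → HasSum (gbar n) 1)
    (hω₁pos : 0 < ω₁) (hω₁lt : ω₁ < 1)
    (hq : ∀ n z, q n z = ω₁ * g₀ z + (1 - ω₁) * gbar n z)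
    (hK : 1 ≤ K)
    (hdomπ : ∀ z, π z ≤ K * g₀ z)
    (hdomgbar : ∀ n, 1 ≤ n → ∀ z, gbar n z ≤ K * g₀ z)
    (α : ℕ → Z → Z → ℝ)
    (hα : ∀ n z z', α n z z' = min 1 ((π z' / π z) * (q n z / q n z')))
    (ν : ℕ → Z → ℝ)
    (hν : ∀ n z, ν n z = ∑' z', α n z z' * q n z')
    (T : ℕ → Z → Z → ℝ)
    (hT : ∀ n z z', T n z z' = α n z z' * q n z'
      + (if z' = z then (1:ℝ) else 0) * (1 - ν n z))
    (a : ℕ → ℝ)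
    (habdd : ∀ n, 1 ≤ n → BddAbove (Set.range fun w => |gbar n w - gbar (n+1) w| / g₀ w))
    (ha : ∀ n, 1 ≤ n → a n = ⨆ w, |gbar n w - gbar (n+1) w| / g₀ w)
    (C r : ℝ) (hC : 0 < C) (hr : 0 < r)
    (hdecay : ∀ n, 1 ≤ n → a n ≤ C * (n : ℝ) ^ (-r))
    (qI : Z → ℝ) (hqIpos : ∀ z, 0 < qI z) (hqIsum : HasSum qI 1)
    (hdomI : ∀ z, qI z ≤ K * g₀ z)
    (μ : ℕ → Z → ℝ) (hμ1 : ∀ z, μ 1 z = qI z)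
    (hμstep : ∀ k, 1 ≤ k → ∀ z', μ (k+1) z' = ∑' z, μ k z * T k z z') :
    Filter.Tendsto
      (fun n => ⨆ A : Set Z, |(∑' z : A, μ n (z : Z)) - ∑' z : A, π (z : Z)|)
      Filter.atTop (nhds 0) := by
  have hK0 : 0 < K := by linarith
  have hqpos : ∀ n, 1 ≤ n → ∀ z, 0 < q n z := fun n hn z => by
    rw [hq]
    have := mul_pos hω₁pos (hg₀pos z)
    have := mul_nonneg (sub_nonneg.2 hω₁lt.le) (hgbarpos n hn z)
    linarith
  have hqsum : ∀ n, 1 ≤ n → HasSum (q n) 1 := fun n hn => by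
    have h := (hg₀sum.mul_left ω₁).add ((hgbarsum n hn).mul_left (1 - ω₁))
    rw [show ω₁ * 1 + (1 - ω₁) * 1 = 1 by ring] at h
    rw [show q n = fun z => ω₁ * g₀ z + (1 - ω₁) * gbar n z from funext (hq n)]
    exact h
  have hqmin : ∀ n, 1 ≤ n → ∀ z, ω₁ / K * π z ≤ q n z := fun n hn z => by
    have h1 : ω₁ / K * π z ≤ ω₁ * g₀ z := by
      calc ω₁ / K * π z ≤ ω₁ / K * (K * g₀ z) := by gcongr; exact hdomπ z
        _ = ω₁ * g₀ z := by field_simp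
    have := mul_nonneg (sub_nonneg.2 hω₁lt.le) (hgbarpos n hn z)
    rw [hq]
    linarith
  have hαq : ∀ n, 1 ≤ n → ∀ z w, α n z w * q n w = min (q n w) (π w * q n z / π z) :=
    fun n hn z w => by
      have := hqpos n hn w
      have := hπpos z
      rw [hα, min_mul_of_nonneg _ _ (hqpos n hn w).le, one_mul]
      congr 1
      field_simp
  have hαmin : ∀ n, 1 ≤ n → ∀ z w, ω₁ / K * π w ≤ α n z w * q n w := fun n hn z w => by
    rw [hαq n hn]
    refine le_min (hqmin n hn w) ?_
    rw [le_div_iff₀ (hπpos z)]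
    nlinarith [mul_le_mul_of_nonneg_left (hqmin n hn z) (hπpos w).le]
  have hαnonneg : ∀ n, 1 ≤ n → ∀ z w, 0 ≤ α n z w * q n w := fun n hn z w =>
    (mul_pos (div_pos hω₁pos hK0) (hπpos w)).le.trans (hαmin n hn z w)
  have hαle : ∀ n, 1 ≤ n → ∀ z w, α n z w * q n w ≤ q n w := fun n hn z w => by
    rw [hαq n hn]
    exact min_le_left _ _
  have hαsum : ∀ n, 1 ≤ n → ∀ z, HasSum (fun w => α n z w * q n w) (ν n z) := fun n hn z => by
    rw [hν]
    exact ((hqsum n hn).summable.of_nonneg_of_le (hαnonneg n hn z) (hαle n hn z)).hasSum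
  have hνle : ∀ n, 1 ≤ n → ∀ z, ν n z ≤ 1 := fun n hn z =>
    hasSum_le (hαle n hn z) (hαsum n hn z) (hqsum n hn)
  have hTmin : ∀ n, 1 ≤ n → ∀ z w, ω₁ / K * π w ≤ T n z w := fun n hn z w => by
    have h1 := hνle n hn z
    have h2 := hαmin n hn z w
    rw [hT]
    split_ifs <;> linarith
  have hTnonneg : ∀ n, 1 ≤ n → ∀ z w, 0 ≤ T n z w := fun n hn z w =>
    (mul_pos (div_pos hω₁pos hK0) (hπpos w)).le.trans (hTmin n hn z w)
  have hTsum : ∀ n, 1 ≤ n → ∀ z, HasSum (T n z) 1 := fun n hn z => by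
    have h := (hαsum n hn z).add ((hasSum_ite_eq z (1 : ℝ)).mul_right (1 - ν n z))
    rw [show ν n z + 1 * (1 - ν n z) = 1 by ring] at h
    convert h using 1
    exact funext fun w => hT n z w
  have hbal : ∀ n, 1 ≤ n → ∀ z w, π z * T n z w = π w * T n w z := fun n hn z w => by
    rcases eq_or_ne z w with rfl | hne
    · rfl
    · have hz := hπpos z
      have hw := hπpos w
      rw [hT, hT, if_neg hne, if_neg hne.symm, hαq n hn, hαq n hn, zero_mul, zero_mul,
        add_zero, add_zero, mul_min_of_nonneg _ _ hz.le, mul_min_of_nonneg _ _ hw.le, min_comm]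
      congr 1 <;> field_simp
  have hinv : ∀ n, 1 ≤ n → ∀ w, ∑' z, π z * T n z w = π w := fun n hn w => by
    simp only [hbal n hn _ w, tsum_mul_left, (hTsum n hn w).tsum_eq, mul_one]
  have hμsum : ∀ n, HasSum (μ (n + 1)) 1 := fun n => by
    induction n with
    | zero =>
      convert hqIsum using 1
      exact funext fun z => hμ1 z
    | succ n ih =>
      have h := hasSum_tsum_mul_kernel (hTnonneg (n + 1) (by lia)) (hTsum (n + 1) (by lia))
        ih.summable
      rw [ih.tsum_eq, mul_one] at h
      convert h using 1
      exact funext fun z => hμstep (n + 1) (by lia) z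
  have hβ0 : 0 < ω₁ / K := div_pos hω₁pos hK0
  have hβ1 : ω₁ / K ≤ 1 := (div_le_one hK0).2 (hω₁lt.le.trans hK)
  have hbound : ∀ n, ∑' z, |μ (n + 1) z - π z| ≤
      (∑' z, |μ 1 z - π z|) * (1 - ω₁ / K) ^ n := fun n => by
    induction n with
    | zero => simp
    | succ n ih =>
      have h := tsum_abs_sub_invariant_le (hTnonneg (n + 1) (by lia)) (hTsum (n + 1) (by lia))
        hπsum (hμsum n) (hinv (n + 1) (by lia)) (hTmin (n + 1) (by lia))
      simp only [← hμstep (n + 1) (by lia)] at h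
      rw [pow_succ, ← mul_assoc]
      exact h.trans (mul_le_mul_of_nonneg_right ih (by linarith))
  rw [← Filter.tendsto_add_atTop_iff_nat 1]
  have hlim : Filter.Tendsto (fun n : ℕ => (∑' z, |μ 1 z - π z|) * (1 - ω₁ / K) ^ n)
      Filter.atTop (nhds 0) := by
    simpa using (tendsto_pow_atTop_nhds_zero_of_lt_one (r := 1 - ω₁ / K) (by linarith)
      (by linarith)).const_mul (∑' z, |μ 1 z - π z|)
  exact squeeze_zero (fun n => Real.iSup_nonneg fun A => abs_nonneg _)
    (fun n => (iSup_abs_tsum_sub_le (hμsum n).summable hπsum.summable).trans (hbound n)) hlim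
end

section
/- (Theorem 2) Assume a_n ≤ C·n^{−r} for some C > 0 and r > 0, and let q_I be a strictly positive probability mass function with q_I(z) ≤ K·g₀(z) for all z. Let (Z_n)_{n≥1} be the inhomogeneous Markov chain on Z with initial distribution q_I and one-step transition kernels T_1, T_2, …, realized on the canonical trajectory space Z^ℕ with the probability measure given by the Ionescu–Tulcea construction. If h : Z → ℝ satisfies Σ_{z∈Z} h(z)²·g₀(z) < ∞, then almost surely (1/n)·Σ_{j=1}^{n} h(Z_j) → Σ_{z∈Z} h(z)·π(z) as n → ∞. -/
open MeasureTheory Filter Topology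
open scoped ENNReal

/-- The measure-valued flow obtained by composing an initial kernel `N` with the kernels
`T i, T (i + 1), …, T (i + k - 1)`. -/
noncomputable def kernelFlow {Z : Type*} (T : ℕ → Z → Z → ℝ≥0∞) (N : Z → Z → ℝ≥0∞) (i : ℕ) :
    ℕ → Z → Z → ℝ≥0∞
  | 0 => N
  | k + 1 => fun x y => ∑' z, kernelFlow T N i k x z * T (i + k) z y

/-- The transition kernel of the inhomogeneous chain from time `i` to time `i + k`. -/
noncomputable abbrev markovFlow {Z : Type*} [DecidableEq Z] (T : ℕ → Z → Z → ℝ≥0∞) (i k : ℕ) :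
    Z → Z → ℝ≥0∞ :=
  kernelFlow T (fun x y => if y = x then 1 else 0) i k

/-- The remainder flow, started from the sum of the Dirac kernel and the invariant law. -/
noncomputable abbrev errorFlow {Z : Type*} [DecidableEq Z] (π : Z → ℝ≥0∞)
    (Q : ℕ → Z → Z → ℝ≥0∞) (i k : ℕ) : Z → Z → ℝ≥0∞ :=
  kernelFlow Q (fun x y => (if y = x then 1 else 0) + π y) i k

/-- Markov kernels `T n`, `n ≥ 1`, with the common invariant law `π`, each splitting as
`b • π + Q n` with a remainder of mass at most `ρ`. -/
structure IsInvariantSplitting {Z : Type*} (π : Z → ℝ≥0∞) (T Q : ℕ → Z → Z → ℝ≥0∞)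
    (b ρ : ℝ≥0∞) : Prop where
  mass_law : ∑' z, π z = 1
  mass_kernel : ∀ n, 1 ≤ n → ∀ z, ∑' y, T n z y = 1
  invariant : ∀ n, 1 ≤ n → ∀ y, ∑' z, π z * T n z y = π y
  split : ∀ n, 1 ≤ n → ∀ z y, T n z y = b * π y + Q n z y
  mass_remainder : ∀ n, 1 ≤ n → ∀ z, ∑' y, Q n z y ≤ ρ

namespace IsInvariantSplitting

variable {Z : Type*} {π : Z → ℝ≥0∞} {T Q : ℕ → Z → Z → ℝ≥0∞} {b ρ : ℝ≥0∞}

theorem law_eq (H : IsInvariantSplitting π T Q b ρ) {n : ℕ} (hn : 1 ≤ n) (y : Z) :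
    π y = b * π y + ∑' z, π z * Q n z y := by
  conv_lhs => rw [← H.invariant n hn y]
  simp_rw [H.split n hn, mul_add, ENNReal.tsum_add, ENNReal.tsum_mul_right, H.mass_law, one_mul]

variable [DecidableEq Z]

theorem tsum_kernelFlow (H : IsInvariantSplitting π T Q b ρ) {i : ℕ} (hi : 1 ≤ i) (k : ℕ) (x : Z) :
    ∑' y, markovFlow T i k x y = 1 := by
  induction k with
  | zero => simp [markovFlow, kernelFlow]
  | succ k ih =>
    simp only [markovFlow, kernelFlow]
    rw [ENNReal.tsum_comm]
    simp_rw [ENNReal.tsum_mul_left, H.mass_kernel (i + k) (by omega), mul_one]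
    exact ih

theorem kernelFlow_succ (H : IsInvariantSplitting π T Q b ρ) {i : ℕ} (hi : 1 ≤ i) (k : ℕ)
    (x y : Z) :
    markovFlow T i (k + 1) x y =
      b * π y + ∑' z, markovFlow T i k x z * Q (i + k) z y := by
  rw [markovFlow, kernelFlow]
  simp_rw [H.split (i + k) (by omega), mul_add, ENNReal.tsum_add, ENNReal.tsum_mul_right,
    H.tsum_kernelFlow hi, one_mul]

theorem kernelFlow_le (H : IsInvariantSplitting π T Q b ρ) {i : ℕ} (hi : 1 ≤ i) (k : ℕ) (x y : Z) :
    markovFlow T i k x y ≤ π y + errorFlow π Q i k x y := by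
  induction k generalizing y with
  | zero => exact le_add_left (le_add_right le_rfl)
  | succ k ih =>
    rw [H.kernelFlow_succ hi]
    conv_rhs => rw [H.law_eq (n := i + k) (by omega) y, errorFlow, kernelFlow, add_assoc,
      ← ENNReal.tsum_add]
    gcongr with z
    rw [← add_mul]
    gcongr
    exact ih z

theorem le_kernelFlow (H : IsInvariantSplitting π T Q b ρ) {i : ℕ} (hi : 1 ≤ i) (k : ℕ) (x y : Z) :
    π y ≤ markovFlow T i k x y + errorFlow π Q i k x y := by
  induction k generalizing y with
  | zero => exact le_add_left (le_add_left le_rfl)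
  | succ k ih =>
    rw [H.kernelFlow_succ hi]
    conv_lhs => rw [H.law_eq (n := i + k) (by omega) y]
    conv_rhs => rw [errorFlow, kernelFlow, add_assoc, ← ENNReal.tsum_add]
    gcongr with z
    rw [← add_mul]
    gcongr
    exact ih z

theorem tsum_errorFlow_le (H : IsInvariantSplitting π T Q b ρ) {i : ℕ} (hi : 1 ≤ i) (k : ℕ)
    (x : Z) : ∑' y, errorFlow π Q i k x y ≤ 2 * ρ ^ k := by
  induction k with
  | zero =>
    simp only [errorFlow, kernelFlow, ENNReal.tsum_add, H.mass_law, tsum_ite_eq]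
    norm_num
  | succ k ih =>
    simp only [errorFlow, kernelFlow]
    rw [ENNReal.tsum_comm]
    simp_rw [ENNReal.tsum_mul_left]
    calc _ ≤ ∑' z, errorFlow π Q i k x z * ρ := by
          gcongr with z
          exact H.mass_remainder (i + k) (by omega) z
      _ ≤ _ := by
          rw [ENNReal.tsum_mul_right, pow_succ, ← mul_assoc]
          gcongr

theorem errorFlow_le (H : IsInvariantSplitting π T Q b ρ) {i : ℕ} (hi : 1 ≤ i) (k : ℕ) (x y : Z) :
    errorFlow π Q i k x y ≤ markovFlow T i k x y + π y := by
  induction k generalizing y with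
  | zero => exact le_rfl
  | succ k ih =>
    conv_rhs => rw [← H.invariant (i + k) (by omega) y, markovFlow, kernelFlow, ← ENNReal.tsum_add]
    change ∑' z, errorFlow π Q i k x z * Q (i + k) z y ≤ _
    gcongr with z
    rw [← add_mul, H.split (i + k) (by omega)]
    gcongr
    · exact ih z
    · exact le_add_self

end IsInvariantSplitting

theorem ENNReal.mul_le_mul_sq_add_inv_mul_sq (u v t : ℝ≥0∞) (ht : t ≠ 0) (ht' : t ≠ ∞) :
    u * v ≤ t⁻¹ * u ^ 2 + t * v ^ 2 := by
  rcases le_total u (t * v) with h | h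
  · calc u * v ≤ (t * v) * v := by gcongr
      _ = t * v ^ 2 := by ring
      _ ≤ _ := le_add_self
  · have hv : v ≤ t⁻¹ * u := by
      calc v = t⁻¹ * (t * v) := by rw [← mul_assoc, ENNReal.inv_mul_cancel ht ht', one_mul]
        _ ≤ _ := by gcongr
    calc u * v ≤ u * (t⁻¹ * u) := by gcongr
      _ = t⁻¹ * u ^ 2 := by ring
      _ ≤ _ := le_self_add

theorem IsInvariantSplitting.tsum_errorFlow_mul_le {Z : Type*} [DecidableEq Z] {π : Z → ℝ≥0∞}
    {T Q : ℕ → Z → Z → ℝ≥0∞} {b s : ℝ≥0∞} (H : IsInvariantSplitting π T Q b (s ^ 2))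
    (hs : s ≠ 0) (hs' : s ≠ ∞) {i : ℕ} (hi : 1 ≤ i) (k : ℕ) (p u v : Z → ℝ≥0∞) :
    ∑' x, ∑' y, p x * errorFlow π Q i k x y * (u x * v y) ≤
      s ^ k * (2 * ∑' x, p x * u x ^ 2 +
        ∑' y, (∑' x, p x * (markovFlow T i k x y + π y))
          * v y ^ 2) := by
  have h0 : s ^ k ≠ 0 := pow_ne_zero _ hs
  have h1 : s ^ k ≠ ∞ := ENNReal.pow_ne_top hs'
  calc ∑' x, ∑' y, p x * errorFlow π Q i k x y * (u x * v y)
      ≤ ∑' x, ∑' y, p x * errorFlow π Q i k x y * ((s ^ k)⁻¹ * u x ^ 2 + s ^ k * v y ^ 2) := by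
        gcongr with x y
        exact ENNReal.mul_le_mul_sq_add_inv_mul_sq _ _ _ h0 h1
    _ = (∑' x, p x * ((s ^ k)⁻¹ * u x ^ 2) * ∑' y, errorFlow π Q i k x y) +
        s ^ k * ∑' y, (∑' x, p x * errorFlow π Q i k x y) * v y ^ 2 := by
        simp_rw [mul_add, ENNReal.tsum_add]
        congr 1
        · simp_rw [← ENNReal.tsum_mul_left]
          exact tsum_congr fun x => tsum_congr fun y => by ring
        · rw [ENNReal.tsum_comm, ← ENNReal.tsum_mul_left]
          simp_rw [← ENNReal.tsum_mul_right, ← ENNReal.tsum_mul_left]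
          exact tsum_congr fun x => tsum_congr fun y => by ring
    _ ≤ (∑' x, p x * ((s ^ k)⁻¹ * u x ^ 2) * (2 * (s ^ 2) ^ k)) +
        s ^ k * ∑' y, (∑' x, p x *
          (markovFlow T i k x y + π y)) * v y ^ 2 := by
        refine add_le_add (ENNReal.tsum_le_tsum fun x => ?_) (mul_le_mul_right
          (ENNReal.tsum_le_tsum fun y => mul_le_mul_left (ENNReal.tsum_le_tsum fun x => ?_) _) _)
        · exact mul_le_mul_right (H.tsum_errorFlow_le hi k x) _
        · exact mul_le_mul_right (H.errorFlow_le hi k x y) _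
    _ = _ := by
        rw [mul_add, ← ENNReal.tsum_mul_left (a := 2)]
        refine congrArg (· + _) ?_
        rw [← ENNReal.tsum_mul_left]
        refine tsum_congr fun x => ?_
        rw [← pow_mul, mul_comm 2 k, pow_mul, sq (s ^ k)]
        calc _ = ((s ^ k)⁻¹ * s ^ k) * (s ^ k * (2 * (p x * u x ^ 2))) := by ring
          _ = _ := by rw [ENNReal.inv_mul_cancel h0 h1, one_mul]

theorem measure_eq_tsum_inter_preimage {Ω β : Type*} [MeasurableSpace Ω] [Countable β]
    [MeasurableSpace β] [MeasurableSingletonClass β] (P : Measure Ω) {W : Ω → β}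
    (hW : Measurable W) (A : Set Ω) :
    P A = ∑' w, P (W ⁻¹' {w} ∩ A) := by
  have h := lintegral_map (μ := P.restrict A) (f := fun _ : β => (1 : ℝ≥0∞)) measurable_const hW
  rw [lintegral_countable'] at h
  simp only [one_mul, lintegral_const, Measure.restrict_apply MeasurableSet.univ,
    Set.univ_inter] at h
  rw [← h]
  exact tsum_congr fun w => by
    rw [Measure.map_apply hW (measurableSet_singleton w),
      Measure.restrict_apply (hW (measurableSet_singleton w))]

/-- The law on `ℕ → Z` of the coordinates from time `1` on is that of an inhomogeneous Markov
chain with initial law `μ` and transition kernels `T 1, T 2, …`. -/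
def IsInhomogeneousChain {Z : Type*} [MeasurableSpace Z] (μ : Z → ℝ≥0∞)
    (T : ℕ → Z → Z → ℝ≥0∞) (P : Measure (ℕ → Z)) : Prop :=
  ∀ n, 1 ≤ n → ∀ f : ℕ → Z, P {ω | ∀ k, 1 ≤ k → k ≤ n → ω k = f k} =
    μ (f 1) * ∏ k ∈ Finset.Ico 1 n, T k (f k) (f (k + 1))

namespace IsInhomogeneousChain

variable {Z : Type*} [Countable Z] [MeasurableSpace Z] [MeasurableSingletonClass Z]
  {μ : Z → ℝ≥0∞} {T : ℕ → Z → Z → ℝ≥0∞} {P : Measure (ℕ → Z)}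

theorem measure_step (H : IsInhomogeneousChain μ T P) {i j : ℕ} (hi : 1 ≤ i) (hij : i ≤ j)
    (x z y : Z) :
    P {ω | ω j = z ∧ ω i = x ∧ ω (j + 1) = y} = P {ω | ω j = z ∧ ω i = x} * T j z y := by
  have hW : Measurable fun (ω : ℕ → Z) (k : Finset.Icc 1 j) => ω k :=
    measurable_pi_lambda _ fun k => measurable_pi_apply _
  rw [measure_eq_tsum_inter_preimage P hW, measure_eq_tsum_inter_preimage P hW,
    ← ENNReal.tsum_mul_right]
  refine tsum_congr fun w => ?_
  have hjm : j ∈ Finset.Icc 1 j := Finset.mem_Icc.2 ⟨hi.trans hij, le_rfl⟩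
  have him : i ∈ Finset.Icc 1 j := Finset.mem_Icc.2 ⟨hi, hij⟩
  by_cases hw : w ⟨j, hjm⟩ = z ∧ w ⟨i, him⟩ = x
  · classical
    obtain ⟨hwj, hwi⟩ := hw
    let f : ℕ → Z := fun k => if hk : k ∈ Finset.Icc 1 j then w ⟨k, hk⟩ else y
    have hf : ∀ k (hk : k ∈ Finset.Icc 1 j), f k = w ⟨k, hk⟩ := fun k hk => dif_pos hk
    have hfy : f (j + 1) = y := dif_neg (by simp)
    have hWf : ∀ ω : ℕ → Z, (fun k : Finset.Icc 1 j => ω k) = w ↔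
        ∀ k, 1 ≤ k → k ≤ j → ω k = f k := by
      intro ω
      rw [funext_iff]
      constructor
      · intro h k h1 h2
        rw [hf k (Finset.mem_Icc.2 ⟨h1, h2⟩), ← h]
      · rintro h ⟨k, hk⟩
        rw [← hf k hk]
        exact h k (Finset.mem_Icc.1 hk).1 (Finset.mem_Icc.1 hk).2
    have e1 : (fun (ω : ℕ → Z) (k : Finset.Icc 1 j) => ω k) ⁻¹' {w} ∩
        {ω | ω j = z ∧ ω i = x} = {ω | ∀ k, 1 ≤ k → k ≤ j → ω k = f k} := by
      ext ω
      simp only [Set.mem_inter_iff, Set.mem_preimage, Set.mem_singleton_iff, Set.mem_ofPred_eq, hWf]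
      refine ⟨fun h => h.1, fun h => ⟨h, ?_, ?_⟩⟩
      · rw [h j (hi.trans hij) le_rfl, hf j hjm, hwj]
      · rw [h i hi hij, hf i him, hwi]
    have e2 : (fun (ω : ℕ → Z) (k : Finset.Icc 1 j) => ω k) ⁻¹' {w} ∩
        {ω | ω j = z ∧ ω i = x ∧ ω (j + 1) = y} =
        {ω | ∀ k, 1 ≤ k → k ≤ j + 1 → ω k = f k} := by
      ext ω
      simp only [Set.mem_inter_iff, Set.mem_preimage, Set.mem_singleton_iff, Set.mem_ofPred_eq, hWf]
      constructor
      · rintro ⟨h, -, -, h'⟩ k h1 h2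
        rcases Nat.le_succ_iff.1 h2 with h3 | rfl
        · exact h k h1 h3
        · exact h'.trans hfy.symm
      · intro h
        refine ⟨fun k h1 h2 => h k h1 (by omega), ?_, ?_, ?_⟩
        · rw [h j (hi.trans hij) (by omega), hf j hjm, hwj]
        · rw [h i hi (by omega), hf i him, hwi]
        · rw [h (j + 1) (by omega) le_rfl, hfy]
    rw [e1, e2, H (j + 1) (by omega), H j (hi.trans hij), Finset.prod_Ico_succ_top (hi.trans hij),
      ← mul_assoc, hfy, hf j hjm, hwj]
  · have e : ∀ S : Set (ℕ → Z), S ⊆ {ω | ω j = z ∧ ω i = x} →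
        (fun (ω : ℕ → Z) (k : Finset.Icc 1 j) => ω k) ⁻¹' {w} ∩ S = ∅ := by
      intro S hS
      refine Set.eq_empty_of_forall_notMem fun ω hω => hw ?_
      obtain ⟨rfl, h⟩ := hω
      exact hS h
    rw [e _ subset_rfl, e _ fun ω h => ⟨h.1, h.2.1⟩]
    simp

theorem measure_pair [DecidableEq Z] (H : IsInhomogeneousChain μ T P) {i : ℕ} (hi : 1 ≤ i) (k : ℕ)
    (x y : Z) :
    P {ω | ω (i + k) = y ∧ ω i = x} = P {ω | ω i = x} * markovFlow T i k x y := by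
  induction k generalizing y with
  | zero =>
    rcases eq_or_ne y x with rfl | hxy
    · simp [markovFlow, kernelFlow]
    · have : {ω : ℕ → Z | ω i = y ∧ ω i = x} = ∅ :=
        Set.eq_empty_of_forall_notMem fun ω h => hxy (h.1.symm.trans h.2)
      simp [markovFlow, kernelFlow, hxy, this]
  | succ k ih =>
    rw [measure_eq_tsum_inter_preimage P (measurable_pi_apply (i + k)), markovFlow, kernelFlow,
      ← ENNReal.tsum_mul_left]
    refine tsum_congr fun z => ?_
    rw [← mul_assoc, ← ih, ← H.measure_step hi (Nat.le_add_right i k)]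
    congr 1
    ext ω
    simp only [Set.mem_inter_iff, Set.mem_preimage, Set.mem_singleton_iff, Set.mem_ofPred_eq,
      ← add_assoc]
    tauto

theorem measure_coord_eq_tsum [DecidableEq Z] (H : IsInhomogeneousChain μ T P) {i : ℕ} (hi : 1 ≤ i)
    (k : ℕ) (y : Z) :
    P {ω | ω (i + k) = y} = ∑' x, P {ω | ω i = x} * markovFlow T i k x y := by
  rw [measure_eq_tsum_inter_preimage P (measurable_pi_apply i)]
  refine tsum_congr fun x => ?_
  rw [← H.measure_pair hi, Set.inter_comm]
  rfl

theorem lintegral_coord (P : Measure (ℕ → Z)) (i : ℕ) (u : Z → ℝ≥0∞) :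
    ∫⁻ ω, u (ω i) ∂P = ∑' x, P {ω | ω i = x} * u x := by
  rw [← lintegral_map (measurable_of_countable u) (measurable_pi_apply i), lintegral_countable']
  refine tsum_congr fun x => ?_
  rw [Measure.map_apply (measurable_pi_apply i) (measurableSet_singleton x), mul_comm]
  rfl

theorem lintegral_pair [DecidableEq Z] (H : IsInhomogeneousChain μ T P) {i : ℕ} (hi : 1 ≤ i)
    (k : ℕ) (u v : Z → ℝ≥0∞) :
    ∫⁻ ω, u (ω i) * v (ω (i + k)) ∂P =
      ∑' x, ∑' y, P {ω | ω i = x} * markovFlow T i k x y * (u x * v y) := by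
  have hm : Measurable fun ω : ℕ → Z => (ω i, ω (i + k)) :=
    (measurable_pi_apply i).prodMk (measurable_pi_apply (i + k))
  rw [← lintegral_map (f := fun z : Z × Z => u z.1 * v z.2) (measurable_of_countable _) hm,
    lintegral_countable', ENNReal.tsum_prod']
  refine tsum_congr fun x => tsum_congr fun y => ?_
  rw [Measure.map_apply hm (measurableSet_singleton _), mul_comm, ← H.measure_pair hi]
  congr 2
  ext ω
  simp [and_comm]

theorem measure_coord_one (H : IsInhomogeneousChain μ T P) (x : Z) : P {ω | ω 1 = x} = μ x := by
  have h := H 1 le_rfl fun _ => x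
  rw [Finset.Ico_self, Finset.prod_empty, mul_one] at h
  rw [← h]
  congr 1
  ext ω
  exact ⟨fun h k h1 h2 => by rwa [le_antisymm h2 h1], fun h => h 1 le_rfl le_rfl⟩

theorem measure_coord_le [DecidableEq Z] [IsProbabilityMeasure P] (H : IsInhomogeneousChain μ T P)
    {G : Z → ℝ≥0∞} {κ ρ M : ℝ≥0∞} (hμ : ∀ x, μ x ≤ M * G x) (hM : κ + ρ * M ≤ M)
    (hT : ∀ n, 1 ≤ n → ∀ z y, T n z y ≤ κ * G y + if z = y then ρ else 0) {n : ℕ} (hn : 1 ≤ n)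
    (y : Z) : P {ω | ω n = y} ≤ M * G y := by
  induction n, hn using Nat.le_induction generalizing y with
  | base => exact (H.measure_coord_one y).trans_le (hμ y)
  | succ n hn ih =>
    have hmass : ∑' x, P {ω | ω n = x} = 1 := by
      have h := lintegral_coord P n fun _ => 1
      simpa using h.symm
    calc P {ω | ω (n + 1) = y} = ∑' z, P {ω | ω n = z} * T n z y := by
          rw [H.measure_coord_eq_tsum hn 1]
          simp [markovFlow, kernelFlow]
      _ ≤ ∑' z, P {ω | ω n = z} * (κ * G y + if z = y then ρ else 0) := by
          gcongr with z
          exact hT n hn z y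
      _ = κ * G y + P {ω | ω n = y} * ρ := by
          simp_rw [mul_add, ENNReal.tsum_add, ENNReal.tsum_mul_right, hmass, one_mul, mul_ite,
            mul_zero]
          rw [tsum_ite_eq]
      _ ≤ κ * G y + (M * G y) * ρ := by
          gcongr
          exact ih y
      _ = (κ + ρ * M) * G y := by ring
      _ ≤ M * G y := by gcongr

end IsInhomogeneousChain

theorem sum_sum_le_of_geometric_decay (c : ℕ → ℕ → ℝ) (hc : ∀ i j, c i j = c j i) {A s : ℝ}
    (hA : 0 ≤ A) (hs0 : 0 ≤ s) (hs1 : s < 1) (h : ∀ i k, c i (i + k) ≤ A * s ^ k) (n : ℕ) :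
    ∑ i ∈ Finset.range n, ∑ j ∈ Finset.range n, c i j ≤ (A + 2 * (A * (1 - s)⁻¹)) * n := by
  induction n with
  | zero => simp
  | succ n ih =>
    have hcross : ∑ i ∈ Finset.range n, c i n ≤ A * (1 - s)⁻¹ := by
      calc ∑ i ∈ Finset.range n, c i n
          = ∑ i ∈ Finset.range n, c (n - 1 - i) n := (Finset.sum_range_reflect (c · n) n).symm
        _ ≤ ∑ i ∈ Finset.range n, A * s ^ i := by
          refine Finset.sum_le_sum fun i hi => ?_
          have hi' := Finset.mem_range.1 hi
          have h1 := h (n - 1 - i) (i + 1)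
          rw [show n - 1 - i + (i + 1) = n by omega] at h1
          exact h1.trans (mul_le_mul_of_nonneg_left
            (pow_le_pow_of_le_one hs0 hs1.le (Nat.le_succ i)) hA)
        _ ≤ A * (1 - s)⁻¹ := by
          rw [← Finset.mul_sum, ← tsum_geometric_of_lt_one hs0 hs1]
          exact mul_le_mul_of_nonneg_left ((summable_geometric_of_lt_one hs0 hs1).sum_le_tsum _
            fun i _ => pow_nonneg hs0 i) hA
    have hdiag : c n n ≤ A := by simpa using h n 0
    have hcross' : ∑ j ∈ Finset.range n, c n j = ∑ i ∈ Finset.range n, c i n :=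
      Finset.sum_congr rfl fun j _ => hc n j
    simp_rw [Finset.sum_range_succ, Finset.sum_add_distrib]
    rw [hcross']
    push_cast
    linarith

theorem integral_sq_sum_sub_le {Ω : Type*} [MeasurableSpace Ω] {P : Measure Ω}
    [IsProbabilityMeasure P] (X : ℕ → Ω → ℝ) (hX : ∀ j, MemLp (X j) 2 P) {A s m : ℝ}
    (hA : 0 ≤ A) (hs0 : 0 ≤ s) (hs1 : s < 1)
    (h : ∀ i k, ∫ ω, (X i ω - m) * (X (i + k) ω - m) ∂P ≤ A * s ^ k) (n : ℕ) :
    ∫ ω, (∑ j ∈ Finset.range n, X j ω - n * m) ^ 2 ∂P ≤ (A + 2 * (A * (1 - s)⁻¹)) * n := by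
  have hY : ∀ j, MemLp (fun ω => X j ω - m) 2 P := fun j => (hX j).sub (memLp_const m)
  have hint : ∀ i j, Integrable (fun ω => (X i ω - m) * (X j ω - m)) P := fun i j =>
    (hY i).integrable_mul (hY j)
  have heq : ∀ ω, (∑ j ∈ Finset.range n, X j ω - n * m) ^ 2 =
      ∑ i ∈ Finset.range n, ∑ j ∈ Finset.range n, (X i ω - m) * (X j ω - m) := by
    intro ω
    rw [← Finset.sum_mul_sum, Finset.sum_sub_distrib]
    simp [sq]
  simp_rw [heq]
  rw [integral_finsetSum _ fun i _ => integrable_finsetSum _ fun j _ => hint i j]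
  simp_rw [integral_finsetSum _ fun j _ => hint _ j]
  exact sum_sum_le_of_geometric_decay _
    (fun i j => integral_congr_ae (.of_forall fun ω => mul_comm _ _)) hA hs0 hs1 h n

theorem ae_tendsto_zero_of_summable_integral {Ω : Type*} [MeasurableSpace Ω] {P : Measure Ω}
    (F : ℕ → Ω → ℝ) (hF : ∀ k, Integrable (F k) P) (hF0 : ∀ k ω, 0 ≤ F k ω) (B : ℕ → ℝ)
    (hB : Summable B) (h : ∀ k, ∫ ω, F k ω ∂P ≤ B k) :
    ∀ᵐ ω ∂P, Tendsto (F · ω) atTop (𝓝 0) := by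
  have hmeas : ∀ k, AEMeasurable (fun ω => ENNReal.ofReal (F k ω)) P := fun k =>
    (hF k).aestronglyMeasurable.aemeasurable.ennreal_ofReal
  have hfin : ∫⁻ ω, ∑' k, ENNReal.ofReal (F k ω) ∂P ≠ ∞ := by
    rw [lintegral_tsum hmeas]
    refine ne_top_of_le_ne_top hB.tsum_ofReal_ne_top (ENNReal.tsum_le_tsum fun k => ?_)
    rw [← ofReal_integral_eq_lintegral_ofReal (hF k) (.of_forall (hF0 k))]
    exact ENNReal.ofReal_le_ofReal (h k)
  filter_upwards [ae_lt_top' (AEMeasurable.tsum hmeas) hfin] with ω hω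
  have h0 := ENNReal.tendsto_atTop_zero_of_tsum_ne_top hω.ne
  have h1 := (ENNReal.tendsto_toReal ENNReal.zero_ne_top).comp h0
  refine h1.congr fun k => ?_
  simp [ENNReal.toReal_ofReal (hF0 k ω)]

/-- A strong law of large numbers for nonnegative variables whose partial sums have
mean square deviation of linear order. -/
theorem ae_tendsto_average_of_integral_sq_le {Ω : Type*} [MeasurableSpace Ω] {P : Measure Ω}
    [IsProbabilityMeasure P] (X : ℕ → Ω → ℝ) (hX : ∀ j, MemLp (X j) 2 P)
    (hX0 : ∀ j ω, 0 ≤ X j ω) {B m : ℝ}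
    (h : ∀ n : ℕ, ∫ ω, (∑ j ∈ Finset.range n, X j ω - n * m) ^ 2 ∂P ≤ B * n) :
    ∀ᵐ ω ∂P, Tendsto (fun n : ℕ => (∑ j ∈ Finset.range n, X j ω) / n) atTop (𝓝 m) := by
  have hS : ∀ n : ℕ, MemLp (fun ω => ∑ j ∈ Finset.range n, X j ω - n * m) 2 P := fun n =>
    (memLp_finsetSum _ fun j _ => hX j).sub (memLp_const _)
  have hsq : ∀ᵐ ω ∂P, Tendsto (fun k : ℕ =>
      ((k : ℝ) ^ 4)⁻¹ * (∑ j ∈ Finset.range (k ^ 2), X j ω - (k ^ 2 : ℕ) * m) ^ 2)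
      atTop (𝓝 0) := by
    refine ae_tendsto_zero_of_summable_integral _ (fun k => (hS (k ^ 2)).integrable_sq.const_mul _)
      (fun k ω => by positivity) (fun k : ℕ => B * ((k : ℝ) ^ 2)⁻¹)
      ((Real.summable_nat_pow_inv.2 one_lt_two).mul_left B) fun k => ?_
    rw [integral_const_mul]
    refine (mul_le_mul_of_nonneg_left (h (k ^ 2)) (by positivity)).trans (le_of_eq ?_)
    rcases eq_or_ne k 0 with rfl | hk
    · simp
    · have : (k : ℝ) ≠ 0 := by exact_mod_cast hk
      push_cast
      field_simp
  filter_upwards [hsq] with ω hω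
  refine tendsto_div_of_monotone_of_exists_subseq_tendsto_div
    (fun n => ∑ j ∈ Finset.range n, X j ω) m
    (monotone_nat_of_le_succ fun n => by
      simp only [Finset.sum_range_succ]; linarith [hX0 n ω]) fun a ha =>
    ⟨fun k => k ^ 2, ?_, tendsto_pow_atTop two_ne_zero, ?_⟩
  · have hlim : Tendsto (fun k : ℕ => (1 + (k : ℝ)⁻¹) ^ 2) atTop (𝓝 1) := by
      simpa using ((tendsto_inv_atTop_nhds_zero_nat (𝕜 := ℝ)).const_add 1).pow 2
    filter_upwards [hlim.eventually_lt_const ha, eventually_gt_atTop 0] with k hk hk0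
    have hk' : (0 : ℝ) < k := by exact_mod_cast hk0
    have : ((k : ℝ) + 1) ^ 2 = (1 + (k : ℝ)⁻¹) ^ 2 * k ^ 2 := by field_simp
    push_cast
    rw [this]
    gcongr
  · have h1 := hω.sqrt
    rw [Real.sqrt_zero] at h1
    rw [tendsto_iff_dist_tendsto_zero]
    refine h1.congr' ?_
    filter_upwards [eventually_gt_atTop 0] with k hk0
    have hk' : (0 : ℝ) < k := by exact_mod_cast hk0
    rw [Real.dist_eq, ← Real.sqrt_sq_eq_abs]
    congr 1
    push_cast
    field_simp

theorem integral_sub_const_mul_sub_const {Ω : Type*} [MeasurableSpace Ω] {P : Measure Ω}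
    [IsProbabilityMeasure P] {X Y : Ω → ℝ} (hX : Integrable X P) (hY : Integrable Y P)
    (hXY : Integrable (fun ω => X ω * Y ω) P) (m : ℝ) :
    ∫ ω, (X ω - m) * (Y ω - m) ∂P =
      ∫ ω, X ω * Y ω ∂P - m * ∫ ω, X ω ∂P - m * ∫ ω, Y ω ∂P + m * m := by
  have h1 : Integrable (fun ω => X ω * Y ω - m * X ω) P := hXY.sub (hX.const_mul m)
  have h2 : Integrable (fun ω => X ω * Y ω - m * X ω - m * Y ω) P := h1.sub (hY.const_mul m)
  have hexp : ∀ ω, (X ω - m) * (Y ω - m) = X ω * Y ω - m * X ω - m * Y ω + m * m :=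
    fun ω => by ring
  simp_rw [hexp]
  rw [integral_add h2 (integrable_const _), integral_sub h1 (hY.const_mul m),
    integral_sub hXY (hX.const_mul m), integral_const_mul, integral_const_mul, integral_const,
    probReal_univ, one_smul]

section Ergodic

variable {Z : Type*} [Countable Z] [MeasurableSpace Z] [MeasurableSingletonClass Z] [DecidableEq Z]
  {π μ G : Z → ℝ≥0∞} {T Q : ℕ → Z → Z → ℝ≥0∞} {b s M : ℝ≥0∞} {P : Measure (ℕ → Z)}

theorem IsInhomogeneousChain.tsum_error_le (H : IsInhomogeneousChain μ T P)
    (S : IsInvariantSplitting π T Q b (s ^ 2)) (hs : s ≠ 0) (hs' : s ≠ ∞)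
    (hp : ∀ n, 1 ≤ n → ∀ x, P {ω | ω n = x} ≤ M * G x) (hπ : ∀ x, π x ≤ M * G x)
    [IsProbabilityMeasure P] {i : ℕ} (hi : 1 ≤ i) (k : ℕ) (u v : Z → ℝ≥0∞) :
    ∑' x, ∑' y, P {ω | ω i = x} * errorFlow π Q i k x y * (u x * v y) ≤
      s ^ k * (2 * ∑' x, P {ω | ω i = x} * u x ^ 2 + 2 * (M * ∑' y, G y * v y ^ 2)) := by
  refine (S.tsum_errorFlow_mul_le hs hs' hi k _ u v).trans ?_
  refine mul_le_mul_right (add_le_add_right ?_ _) _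
  rw [← ENNReal.tsum_mul_left (a := M), ← ENNReal.tsum_mul_left]
  refine ENNReal.tsum_le_tsum fun y => ?_
  simp_rw [mul_add, ENNReal.tsum_add, ENNReal.tsum_mul_right]
  have hmass : ∑' x, P {ω | ω i = x} = 1 := by
    have h := IsInhomogeneousChain.lintegral_coord P i fun _ => 1
    simpa using h.symm
  rw [← H.measure_coord_eq_tsum hi, hmass, one_mul]
  calc _ ≤ (M * G y + M * G y) * v y ^ 2 := by
        gcongr
        · exact hp _ (by omega) y
        · exact hπ y
    _ = _ := by ring

theorem IsInhomogeneousChain.lintegral_mul_le (H : IsInhomogeneousChain μ T P)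
    (S : IsInvariantSplitting π T Q b (s ^ 2)) (hs : s ≠ 0) (hs' : s ≠ ∞)
    (hp : ∀ n, 1 ≤ n → ∀ x, P {ω | ω n = x} ≤ M * G x) (hπ : ∀ x, π x ≤ M * G x)
    [IsProbabilityMeasure P] {i : ℕ} (hi : 1 ≤ i) (k : ℕ) (v : Z → ℝ≥0∞) :
    ∫⁻ ω, v (ω i) * v (ω (i + k)) ∂P ≤ (∫⁻ ω, v (ω i) ∂P) * (∑' y, π y * v y) +
      s ^ k * (4 * (M * ∑' y, G y * v y ^ 2)) := by
  have h2 : ∑' x, P {ω | ω i = x} * v x ^ 2 ≤ M * ∑' y, G y * v y ^ 2 := by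
    rw [← ENNReal.tsum_mul_left]
    refine ENNReal.tsum_le_tsum fun x => ?_
    rw [← mul_assoc]
    gcongr
    exact hp i hi x
  calc ∫⁻ ω, v (ω i) * v (ω (i + k)) ∂P
      = ∑' x, ∑' y, P {ω | ω i = x} * markovFlow T i k x y * (v x * v y) :=
        H.lintegral_pair hi k v v
    _ ≤ ∑' x, ∑' y, P {ω | ω i = x} * (π y + errorFlow π Q i k x y) * (v x * v y) := by
        gcongr with x y
        exact S.kernelFlow_le hi k x y
    _ = (∫⁻ ω, v (ω i) ∂P) * (∑' y, π y * v y) +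
        ∑' x, ∑' y, P {ω | ω i = x} * errorFlow π Q i k x y * (v x * v y) := by
        rw [IsInhomogeneousChain.lintegral_coord P i v, ← ENNReal.tsum_mul_right]
        simp_rw [← ENNReal.tsum_mul_left, ← ENNReal.tsum_add]
        refine tsum_congr fun x => tsum_congr fun y => ?_
        ring
    _ ≤ _ := by
        gcongr
        refine (H.tsum_error_le S hs hs' hp hπ hi k v v).trans ?_
        gcongr
        calc _ ≤ 2 * (M * ∑' y, G y * v y ^ 2) + 2 * (M * ∑' y, G y * v y ^ 2) := by gcongr
          _ = _ := by ring

theorem IsInhomogeneousChain.tsum_law_mul_le (H : IsInhomogeneousChain μ T P)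
    (S : IsInvariantSplitting π T Q b (s ^ 2)) (hs : s ≠ 0) (hs' : s ≠ ∞)
    (hp : ∀ n, 1 ≤ n → ∀ x, P {ω | ω n = x} ≤ M * G x) (hπ : ∀ x, π x ≤ M * G x)
    [IsProbabilityMeasure P] (k : ℕ) (v : Z → ℝ≥0∞) :
    ∑' y, π y * v y ≤ (∫⁻ ω, v (ω (1 + k)) ∂P) +
      s ^ k * (2 + 2 * (M * ∑' y, G y * v y ^ 2)) := by
  have hmass : ∑' x, P {ω | ω 1 = x} = 1 := by
    have h := IsInhomogeneousChain.lintegral_coord P 1 fun _ => 1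
    simpa using h.symm
  have h1 := H.lintegral_pair le_rfl k (fun _ => 1) v
  have h2 := H.tsum_error_le S hs hs' hp hπ le_rfl k (fun _ => 1) v
  simp only [one_mul, one_pow, mul_one, hmass] at h1 h2
  calc ∑' y, π y * v y = ∑' x, ∑' y, P {ω | ω 1 = x} * π y * v y := by
        simp_rw [mul_assoc, ENNReal.tsum_mul_left, ENNReal.tsum_mul_right, hmass, one_mul]
    _ ≤ ∑' x, ∑' y, P {ω | ω 1 = x} * (markovFlow T 1 k x y + errorFlow π Q 1 k x y) * v y := by
        gcongr with x y
        exact S.le_kernelFlow le_rfl k x y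
    _ = (∫⁻ ω, v (ω (1 + k)) ∂P) +
        ∑' x, ∑' y, P {ω | ω 1 = x} * errorFlow π Q 1 k x y * v y := by
        rw [h1]
        simp_rw [← ENNReal.tsum_add]
        refine tsum_congr fun x => tsum_congr fun y => ?_
        ring
    _ ≤ _ := by gcongr

theorem IsInhomogeneousChain.ae_tendsto_average_of_nonneg (H : IsInhomogeneousChain μ T P)
    (S : IsInvariantSplitting π T Q b (s ^ 2)) (hs : s ≠ 0) (hs1 : s < 1)
    (hp : ∀ n, 1 ≤ n → ∀ x, P {ω | ω n = x} ≤ M * G x) (hπ : ∀ x, π x ≤ M * G x) (hM : M ≠ ∞)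
    [IsProbabilityMeasure P] {h : Z → ℝ} (h0 : ∀ z, 0 ≤ h z)
    (hL : ∑' z, G z * ENNReal.ofReal (h z) ^ 2 ≠ ∞) :
    ∀ᵐ ω ∂P, Tendsto (fun n : ℕ => (∑ j ∈ Finset.range n, h (ω (j + 1))) / n) atTop
      (𝓝 (∑' z, π z * ENNReal.ofReal (h z)).toReal) := by
  set v : Z → ℝ≥0∞ := fun z => ENNReal.ofReal (h z) with hv
  set A : ℝ≥0∞ := 2 + 4 * (M * ∑' y, G y * v y ^ 2) with hA
  have hs' : s ≠ ∞ := (hs1.trans ENNReal.one_lt_top).ne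
  have hA' : A ≠ ∞ := by finiteness
  have hmeas : ∀ i, Measurable fun ω : ℕ → Z => h (ω i) := fun i =>
    (measurable_of_countable h).comp (measurable_pi_apply i)
  have hL2 : ∀ j, MemLp (fun ω : ℕ → Z => h (ω (j + 1))) 2 P := by
    intro j
    rw [memLp_two_iff_integrable_sq (hmeas _).aestronglyMeasurable]
    refine ⟨((hmeas _).pow_const 2).aestronglyMeasurable, ?_⟩
    rw [hasFiniteIntegral_iff_ofReal (.of_forall fun ω => sq_nonneg _)]
    simp_rw [ENNReal.ofReal_pow (h0 _)]
    rw [IsInhomogeneousChain.lintegral_coord P (j + 1) fun z => v z ^ 2]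
    calc _ ≤ ∑' x, M * G x * v x ^ 2 := by
          gcongr with x
          exact hp _ (by omega) x
      _ < ∞ := by
          simp_rw [mul_assoc, ENNReal.tsum_mul_left]
          exact ENNReal.mul_lt_top hM.lt_top hL.lt_top
  have hint : ∀ j, Integrable (fun ω : ℕ → Z => h (ω (j + 1))) P := fun j =>
    (hL2 j).integrable one_le_two
  have hint2 : ∀ i j, Integrable (fun ω : ℕ → Z => h (ω (i + 1)) * h (ω (j + 1))) P := fun i j =>
    (hL2 i).integrable_mul (hL2 j)
  have hE : ∀ j, ∫⁻ ω, v (ω (j + 1)) ∂P = ENNReal.ofReal (∫ ω, h (ω (j + 1)) ∂P) := fun j =>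
    (ofReal_integral_eq_lintegral_ofReal (hint j) (.of_forall fun ω => h0 _)).symm
  have hE2 : ∀ i j, ∫⁻ ω, v (ω (i + 1)) * v (ω (j + 1)) ∂P =
      ENNReal.ofReal (∫ ω, h (ω (i + 1)) * h (ω (j + 1)) ∂P) := by
    intro i j
    rw [ofReal_integral_eq_lintegral_ofReal (hint2 i j)
      (.of_forall fun ω => mul_nonneg (h0 _) (h0 _))]
    simp_rw [ENNReal.ofReal_mul (h0 _), hv]
  have hE0 : ∀ j, 0 ≤ ∫ ω, h (ω (j + 1)) ∂P := fun j => integral_nonneg fun ω => h0 _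
  have hlaw : ∀ k, ∑' y, π y * v y ≤ ENNReal.ofReal (∫ ω, h (ω (k + 1)) ∂P) + s ^ k * A := by
    intro k
    rw [← hE, add_comm k 1]
    refine (H.tsum_law_mul_le S hs hs' hp hπ k v).trans ?_
    rw [hA]
    gcongr
    norm_num
  have hfin : ∑' y, π y * v y ≠ ∞ := ne_top_of_le_ne_top (by finiteness) (hlaw 0)
  set m : ℝ := (∑' y, π y * v y).toReal with hm
  have hm0 : 0 ≤ m := ENNReal.toReal_nonneg
  have hmean : ∀ k, m ≤ ∫ ω, h (ω (k + 1)) ∂P + s.toReal ^ k * A.toReal := by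
    intro k
    have h1 := ENNReal.toReal_mono (by finiteness) (hlaw k)
    rwa [ENNReal.toReal_add (by finiteness) (by finiteness), ENNReal.toReal_ofReal (hE0 k),
      ENNReal.toReal_mul, ENNReal.toReal_pow] at h1
  have hcorr : ∀ i k, ∫ ω, h (ω (i + 1)) * h (ω (i + k + 1)) ∂P ≤
      (∫ ω, h (ω (i + 1)) ∂P) * m + s.toReal ^ k * A.toReal := by
    intro i k
    have h1 : ENNReal.ofReal (∫ ω, h (ω (i + 1)) * h (ω (i + k + 1)) ∂P) ≤
        ENNReal.ofReal (∫ ω, h (ω (i + 1)) ∂P) * (∑' y, π y * v y) + s ^ k * A := by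
      rw [← hE, ← hE2, show i + k + 1 = i + 1 + k by ring]
      refine (H.lintegral_mul_le S hs hs' hp hπ (Nat.le_add_left 1 i) k v).trans ?_
      rw [hA]
      gcongr
      exact le_add_self
    have h2 := ENNReal.toReal_mono (by finiteness) h1
    rwa [ENNReal.toReal_add (by finiteness) (by finiteness), ENNReal.toReal_mul,
      ENNReal.toReal_ofReal (hE0 i), ENNReal.toReal_mul, ENNReal.toReal_pow,
      ENNReal.toReal_ofReal (integral_nonneg fun ω => mul_nonneg (h0 _) (h0 _))] at h2
  have ht0 : 0 ≤ s.toReal := ENNReal.toReal_nonneg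
  have ht1 : s.toReal < 1 := by
    simpa using (ENNReal.toReal_lt_toReal hs' ENNReal.one_ne_top).2 hs1
  have hA0 : 0 ≤ A.toReal := ENNReal.toReal_nonneg
  have hcov : ∀ i k, ∫ ω, (h (ω (i + 1)) - m) * (h (ω (i + k + 1)) - m) ∂P ≤
      ((1 + m) * A.toReal) * s.toReal ^ k := by
    intro i k
    rw [integral_sub_const_mul_sub_const (hint i) (hint (i + k)) (hint2 i (i + k))]
    have h1 := hcorr i k
    have h2 : m * m ≤ m * (∫ ω, h (ω (i + k + 1)) ∂P + s.toReal ^ k * A.toReal) := by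
      refine mul_le_mul_of_nonneg_left ((hmean (i + k)).trans ?_) hm0
      gcongr 1
      exact mul_le_mul_of_nonneg_right (pow_le_pow_of_le_one ht0 ht1.le (by omega)) hA0
    nlinarith
  have hA1 : 0 ≤ (1 + m) * A.toReal := by positivity
  have hvar := integral_sq_sum_sub_le (fun j (ω : ℕ → Z) => h (ω (j + 1))) hL2 hA1 ht0 ht1 hcov
  exact ae_tendsto_average_of_integral_sq_le (fun j (ω : ℕ → Z) => h (ω (j + 1))) hL2
    (fun j ω => h0 _) hvar

end Ergodic

/-- The sub-probability of proposing `z'` from `z` with proposal law `q` and accepting it. -/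
noncomputable def acceptedFlow {Z : Type*} (π q : Z → ℝ) (z z' : Z) : ℝ :=
  min 1 ((π z' / π z) * (q z / q z')) * q z'

/-- The independent Metropolis–Hastings kernel with target `π` and proposal `q`. -/
noncomputable def metropolisKernel {Z : Type*} [DecidableEq Z] (π q : Z → ℝ) (z z' : Z) : ℝ :=
  acceptedFlow π q z z' + (if z' = z then (1 : ℝ) else 0) * (1 - ∑' w, acceptedFlow π q z w)

section Metropolis

variable {Z : Type*} {π q : Z → ℝ} {β : ℝ}

theorem acceptedFlow_eq (hπ : ∀ z, 0 < π z) (hq : ∀ z, 0 < q z) (z z' : Z) :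
    acceptedFlow π q z z' = min (q z') (π z' * q z / π z) := by
  have h1 := (hπ z).ne'
  have h2 := (hq z').ne'
  rw [acceptedFlow, min_mul_of_nonneg _ _ (hq z').le, one_mul]
  congr 1
  field_simp

theorem acceptedFlow_nonneg (hπ : ∀ z, 0 < π z) (hq : ∀ z, 0 < q z) (z z' : Z) :
    0 ≤ acceptedFlow π q z z' := by
  rw [acceptedFlow_eq hπ hq]
  exact le_min (hq z').le (div_nonneg (mul_nonneg (hπ z').le (hq z).le) (hπ z).le)

theorem acceptedFlow_le (hπ : ∀ z, 0 < π z) (hq : ∀ z, 0 < q z) (z z' : Z) :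
    acceptedFlow π q z z' ≤ q z' := by
  rw [acceptedFlow_eq hπ hq]
  exact min_le_left _ _

theorem mul_le_acceptedFlow (hπ : ∀ z, 0 < π z) (hq : ∀ z, 0 < q z) (hβ : ∀ z, β * π z ≤ q z)
    (z z' : Z) : β * π z' ≤ acceptedFlow π q z z' := by
  rw [acceptedFlow_eq hπ hq, le_min_iff, le_div_iff₀ (hπ z)]
  refine ⟨hβ z', ?_⟩
  nlinarith [mul_le_mul_of_nonneg_left (hβ z) (hπ z').le]

theorem mul_acceptedFlow_comm (hπ : ∀ z, 0 < π z) (hq : ∀ z, 0 < q z) (z z' : Z) :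
    π z * acceptedFlow π q z z' = π z' * acceptedFlow π q z' z := by
  have h1 := (hπ z).ne'
  have h2 := (hπ z').ne'
  rw [acceptedFlow_eq hπ hq, acceptedFlow_eq hπ hq, mul_min_of_nonneg _ _ (hπ z).le,
    mul_min_of_nonneg _ _ (hπ z').le, min_comm]
  congr 1 <;> field_simp

theorem summable_acceptedFlow (hπ : ∀ z, 0 < π z) (hq : ∀ z, 0 < q z) (hqs : HasSum q 1) (z : Z) :
    Summable (acceptedFlow π q z) :=
  .of_nonneg_of_le (acceptedFlow_nonneg hπ hq z) (acceptedFlow_le hπ hq z) hqs.summable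

theorem tsum_acceptedFlow_le_one (hπ : ∀ z, 0 < π z) (hq : ∀ z, 0 < q z) (hqs : HasSum q 1)
    (z : Z) : ∑' w, acceptedFlow π q z w ≤ 1 := by
  rw [← hqs.tsum_eq]
  exact (summable_acceptedFlow hπ hq hqs z).tsum_le_tsum (acceptedFlow_le hπ hq z) hqs.summable

theorem le_tsum_acceptedFlow (hπ : ∀ z, 0 < π z) (hπs : HasSum π 1) (hq : ∀ z, 0 < q z)
    (hqs : HasSum q 1) (hβ : ∀ z, β * π z ≤ q z) (z : Z) : β ≤ ∑' w, acceptedFlow π q z w := by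
  have h := (hπs.mul_left β).tsum_eq
  rw [mul_one] at h
  rw [← h]
  exact (hπs.mul_left β).summable.tsum_le_tsum (mul_le_acceptedFlow hπ hq hβ z)
    (summable_acceptedFlow hπ hq hqs z)

variable [DecidableEq Z]

theorem mul_le_metropolisKernel (hπ : ∀ z, 0 < π z) (hq : ∀ z, 0 < q z) (hqs : HasSum q 1)
    (hβ : ∀ z, β * π z ≤ q z) (z z' : Z) : β * π z' ≤ metropolisKernel π q z z' := by
  refine (mul_le_acceptedFlow hπ hq hβ z z').trans (le_add_of_nonneg_right (mul_nonneg ?_ ?_))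
  · split_ifs <;> norm_num
  · linarith [tsum_acceptedFlow_le_one hπ hq hqs z]

theorem metropolisKernel_le (hπ : ∀ z, 0 < π z) (hπs : HasSum π 1) (hq : ∀ z, 0 < q z)
    (hqs : HasSum q 1) (hβ : ∀ z, β * π z ≤ q z) (z z' : Z) :
    metropolisKernel π q z z' ≤ q z' + if z = z' then 1 - β else 0 := by
  refine add_le_add (acceptedFlow_le hπ hq z z') ?_
  simp only [eq_comm (a := z') (b := z)]
  split_ifs
  · linarith [le_tsum_acceptedFlow hπ hπs hq hqs hβ z]
  · simp

theorem hasSum_metropolisKernel (hπ : ∀ z, 0 < π z) (hq : ∀ z, 0 < q z) (hqs : HasSum q 1)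
    (z : Z) : HasSum (metropolisKernel π q z) 1 := by
  have h := (summable_acceptedFlow hπ hq hqs z).hasSum.add
    ((hasSum_ite_eq z (1 : ℝ)).mul_right (1 - ∑' w, acceptedFlow π q z w))
  rw [one_mul, add_sub_cancel] at h
  exact h

theorem mul_metropolisKernel_comm (hπ : ∀ z, 0 < π z) (hq : ∀ z, 0 < q z) (z z' : Z) :
    π z * metropolisKernel π q z z' = π z' * metropolisKernel π q z' z := by
  rcases eq_or_ne z z' with rfl | h
  · rfl
  · simp [metropolisKernel, h, h.symm, mul_acceptedFlow_comm hπ hq z z']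

end Metropolis

theorem isInvariantSplitting_metropolisKernel {Z : Type*} [DecidableEq Z] {π : Z → ℝ}
    {q : ℕ → Z → ℝ} {β : ℝ} (hπ : ∀ z, 0 < π z) (hπs : HasSum π 1)
    (hq : ∀ n, 1 ≤ n → ∀ z, 0 < q n z) (hqs : ∀ n, 1 ≤ n → HasSum (q n) 1) (hβ0 : 0 ≤ β)
    (hβ : ∀ n, 1 ≤ n → ∀ z, β * π z ≤ q n z) :
    IsInvariantSplitting (fun z => ENNReal.ofReal (π z))
      (fun n z y => ENNReal.ofReal (metropolisKernel π (q n) z y))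
      (fun n z y => ENNReal.ofReal (metropolisKernel π (q n) z y - β * π y))
      (ENNReal.ofReal β) (ENNReal.ofReal (1 - β)) where
  mass_law := by
    rw [← ENNReal.ofReal_tsum_of_nonneg (fun z => (hπ z).le) hπs.summable, hπs.tsum_eq,
      ENNReal.ofReal_one]
  mass_kernel n hn z := by
    have h := hasSum_metropolisKernel hπ (hq n hn) (hqs n hn) z
    rw [← ENNReal.ofReal_tsum_of_nonneg (fun y => (mul_nonneg hβ0 (hπ y).le).trans
      (mul_le_metropolisKernel hπ (hq n hn) (hqs n hn) (hβ n hn) z y)) h.summable, h.tsum_eq,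
      ENNReal.ofReal_one]
  invariant n hn y := by
    have h := hasSum_metropolisKernel hπ (hq n hn) (hqs n hn) y
    simp_rw [← ENNReal.ofReal_mul (hπ _).le, mul_metropolisKernel_comm hπ (hq n hn) _ y,
      ENNReal.ofReal_mul (hπ _).le, ENNReal.tsum_mul_left]
    rw [← ENNReal.ofReal_tsum_of_nonneg (fun x => (mul_nonneg hβ0 (hπ x).le).trans
      (mul_le_metropolisKernel hπ (hq n hn) (hqs n hn) (hβ n hn) y x)) h.summable, h.tsum_eq,
      ENNReal.ofReal_one, mul_one]
  split n hn z y := by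
    rw [← ENNReal.ofReal_mul hβ0, ← ENNReal.ofReal_add (mul_nonneg hβ0 (hπ y).le)
      (sub_nonneg.2 (mul_le_metropolisKernel hπ (hq n hn) (hqs n hn) (hβ n hn) z y)),
      add_sub_cancel]
  mass_remainder n hn z := by
    have h := (hasSum_metropolisKernel hπ (hq n hn) (hqs n hn) z).sub (hπs.mul_left β)
    rw [mul_one] at h
    rw [← ENNReal.ofReal_tsum_of_nonneg (fun y => sub_nonneg.2
      (mul_le_metropolisKernel hπ (hq n hn) (hqs n hn) (hβ n hn) z y)) h.summable, h.tsum_eq]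

theorem ae_tendsto_average_of_forall_nonneg {Ω Z : Type*} [MeasurableSpace Ω] {P : Measure Ω}
    {X : ℕ → Ω → Z} {π g : Z → ℝ} {K : ℝ} (hπ : ∀ z, 0 < π z) (hg : ∀ z, 0 < g z)
    (hgs : Summable g) (hπg : ∀ z, π z ≤ K * g z)
    (H : ∀ h : Z → ℝ, (∀ z, 0 ≤ h z) → (Summable fun z => h z ^ 2 * g z) →
      ∀ᵐ ω ∂P, Tendsto (fun n : ℕ => (∑ j ∈ Finset.range n, h (X (j + 1) ω)) / n) atTop
        (𝓝 (∑' z, h z * π z)))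
    (h : Z → ℝ) (hsq : Summable fun z => h z ^ 2 * g z) :
    ∀ᵐ ω ∂P, Tendsto (fun n : ℕ => (1 / (n : ℝ)) * ∑ j ∈ Finset.Icc 1 n, h (X j ω)) atTop
      (𝓝 (∑' z, h z * π z)) := by
  have hpart : ∀ f : Z → ℝ, (∀ z, |f z| ≤ |h z|) → Summable fun z => f z ^ 2 * g z := fun f hf =>
    .of_nonneg_of_le (fun z => mul_nonneg (sq_nonneg _) (hg z).le)
      (fun z => mul_le_mul_of_nonneg_right (sq_le_sq.2 (hf z)) (hg z).le) hsq
  have hint : ∀ f : Z → ℝ, (∀ z, 0 ≤ f z) → (Summable fun z => f z ^ 2 * g z) →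
      Summable fun z => f z * π z := fun f hf hs =>
    .of_nonneg_of_le (fun z => mul_nonneg (hf z) (hπ z).le)
      (fun z => by
        calc f z * π z ≤ (1 + f z ^ 2) * (K * g z) :=
              mul_le_mul (by nlinarith [sq_nonneg (f z - 1), hf z]) (hπg z) (hπ z).le
                (by positivity)
          _ = K * (g z + f z ^ 2 * g z) := by ring)
      ((hgs.add hs).mul_left K)
  have hp := hpart (fun z => (h z)⁺) fun z => by
    rw [abs_of_nonneg (posPart_nonneg _)]; exact sup_le (le_abs_self _) (abs_nonneg _)
  have hm := hpart (fun z => (h z)⁻) fun z => by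
    rw [abs_of_nonneg (negPart_nonneg _)]; exact sup_le (neg_le_abs _) (abs_nonneg _)
  have hp0 : ∀ z, 0 ≤ (h z)⁺ := fun z => posPart_nonneg _
  have hm0 : ∀ z, 0 ≤ (h z)⁻ := fun z => negPart_nonneg _
  have hlim : ∑' z, h z * π z = ∑' z, (h z)⁺ * π z - ∑' z, (h z)⁻ * π z := by
    rw [← (hint _ hp0 hp).tsum_sub (hint _ hm0 hm)]
    refine tsum_congr fun z => ?_
    rw [← sub_mul, posPart_sub_negPart]
  filter_upwards [H _ hp0 hp, H _ hm0 hm] with ω h1 h2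
  rw [hlim]
  refine (h1.sub h2).congr fun n => ?_
  rw [← sub_div, ← Finset.sum_sub_distrib, div_eq_inv_mul, one_div]
  simp_rw [posPart_sub_negPart]
  rw [Finset.range_eq_Ico, Finset.sum_Ico_add' (fun j => h (X j ω)), zero_add,
    Finset.Ico_add_one_right_eq_Icc]

theorem ae_tendsto_average_metropolisKernel {Z : Type*} [Countable Z] [DecidableEq Z]
    [MeasurableSpace Z] [MeasurableSingletonClass Z] {π g qI : Z → ℝ} {q : ℕ → Z → ℝ} {β K : ℝ}
    (hπ : ∀ z, 0 < π z) (hπs : HasSum π 1) (hg : ∀ z, 0 < g z)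
    (hq : ∀ n, 1 ≤ n → ∀ z, 0 < q n z) (hqs : ∀ n, 1 ≤ n → HasSum (q n) 1)
    (hβ0 : 0 < β) (hβ1 : β < 1) (hK : 0 < K) (hqπ : ∀ n, 1 ≤ n → ∀ z, β * π z ≤ q n z)
    (hqg : ∀ n, 1 ≤ n → ∀ z, q n z ≤ K * g z) (hπg : ∀ z, π z ≤ K * g z)
    (hIg : ∀ z, qI z ≤ K * g z) {P : Measure (ℕ → Z)} [IsProbabilityMeasure P]
    (H : IsInhomogeneousChain (fun z => ENNReal.ofReal (qI z))
      (fun n z y => ENNReal.ofReal (metropolisKernel π (q n) z y)) P)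
    (f : Z → ℝ) (hf0 : ∀ z, 0 ≤ f z) (hf : Summable fun z => f z ^ 2 * g z) :
    ∀ᵐ ω ∂P, Tendsto (fun n : ℕ => (∑ j ∈ Finset.range n, f (ω (j + 1))) / n) atTop
      (𝓝 (∑' z, f z * π z)) := by
  have S := isInvariantSplitting_metropolisKernel hπ hπs hq hqs hβ0.le hqπ
  have hsqrt : ENNReal.ofReal (1 - β) = ENNReal.ofReal √(1 - β) ^ 2 := by
    rw [← ENNReal.ofReal_pow (Real.sqrt_nonneg _), Real.sq_sqrt (by linarith)]
  rw [hsqrt] at S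
  have hdom : ∀ f : Z → ℝ, (∀ z, f z ≤ K * g z) → ∀ z,
      ENNReal.ofReal (f z) ≤ ENNReal.ofReal (K / β) * ENNReal.ofReal (g z) := fun f hf z => by
    rw [← ENNReal.ofReal_mul (by positivity)]
    refine ENNReal.ofReal_le_ofReal ((hf z).trans (mul_le_mul_of_nonneg_right ?_ (hg z).le))
    exact le_div_self hK.le hβ0 hβ1.le
  have hstep : ENNReal.ofReal K + ENNReal.ofReal (1 - β) * ENNReal.ofReal (K / β) ≤
      ENNReal.ofReal (K / β) := by
    rw [← ENNReal.ofReal_mul (by linarith),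
      ← ENNReal.ofReal_add hK.le (mul_nonneg (by linarith) (by positivity))]
    refine ENNReal.ofReal_le_ofReal (le_of_eq ?_)
    field_simp
    ring
  have hker : ∀ n, 1 ≤ n → ∀ z y, ENNReal.ofReal (metropolisKernel π (q n) z y) ≤
      ENNReal.ofReal K * ENNReal.ofReal (g y) +
        (if z = y then ENNReal.ofReal (1 - β) else 0) := fun n hn z y => by
    have h1 := (metropolisKernel_le hπ hπs (hq n hn) (hqs n hn) (hqπ n hn) z y).trans
      (add_le_add_left (hqg n hn y) _)
    have h2 := ENNReal.ofReal_le_ofReal h1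
    rw [ENNReal.ofReal_add (mul_nonneg hK.le (hg y).le) (by split_ifs <;> linarith),
      ENNReal.ofReal_mul hK.le] at h2
    refine h2.trans (le_of_eq ?_)
    split_ifs <;> simp
  have hp : ∀ n, 1 ≤ n → ∀ x, P {ω | ω n = x} ≤
      ENNReal.ofReal (K / β) * ENNReal.ofReal (g x) := fun n hn x =>
    H.measure_coord_le (G := fun z => ENNReal.ofReal (g z)) (κ := ENNReal.ofReal K)
      (ρ := ENNReal.ofReal (1 - β)) (hdom qI hIg) hstep hker hn x
  have hL : ∑' z, ENNReal.ofReal (g z) * ENNReal.ofReal (f z) ^ 2 ≠ ⊤ := by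
    simp_rw [← ENNReal.ofReal_pow (hf0 _), ← ENNReal.ofReal_mul (hg _).le, mul_comm (g _)]
    exact hf.tsum_ofReal_ne_top
  have hlim : (∑' z, ENNReal.ofReal (π z) * ENNReal.ofReal (f z)).toReal = ∑' z, f z * π z := by
    rw [ENNReal.tsum_toReal_eq fun z => ENNReal.mul_ne_top ENNReal.ofReal_ne_top
      ENNReal.ofReal_ne_top]
    refine tsum_congr fun z => ?_
    rw [ENNReal.toReal_mul, ENNReal.toReal_ofReal (hπ z).le, ENNReal.toReal_ofReal (hf0 z),
      mul_comm]
  have hs0 : ENNReal.ofReal √(1 - β) ≠ 0 :=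
    (ENNReal.ofReal_pos.2 (Real.sqrt_pos.2 (by linarith))).ne'
  have hs1 : ENNReal.ofReal √(1 - β) < 1 := by
    rw [ENNReal.ofReal_lt_one, Real.sqrt_lt' one_pos]
    linarith
  rw [← hlim]
  exact H.ae_tendsto_average_of_nonneg S hs0 hs1 hp (hdom π hπg) ENNReal.ofReal_ne_top hf0 hL

theorem thm2 {Z : Type*} [Countable Z] [DecidableEq Z] [MeasurableSpace Z] [MeasurableSingletonClass Z]
    (π g₀ : Z → ℝ) (gbar : ℕ → Z → ℝ) (q : ℕ → Z → ℝ) (ω₁ K : ℝ)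
    (hπpos : ∀ z, 0 < π z) (hπsum : HasSum π 1)
    (hg₀pos : ∀ z, 0 < g₀ z) (hg₀sum : HasSum g₀ 1)
    (hgbarpos : ∀ n, 1 ≤ n → ∀ z, 0 ≤ gbar n z)
    (hgbarsum : ∀ n, 1 ≤ n → HasSum (gbar n) 1)
    (hω₁pos : 0 < ω₁) (hω₁lt : ω₁ < 1)
    (hq : ∀ n z, q n z = ω₁ * g₀ z + (1 - ω₁) * gbar n z)
    (hK : 1 ≤ K)
    (hdomπ : ∀ z, π z ≤ K * g₀ z)
    (hdomgbar : ∀ n, 1 ≤ n → ∀ z, gbar n z ≤ K * g₀ z)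
    (α : ℕ → Z → Z → ℝ)
    (hα : ∀ n z z', α n z z' = min 1 ((π z' / π z) * (q n z / q n z')))
    (ν : ℕ → Z → ℝ)
    (hν : ∀ n z, ν n z = ∑' z', α n z z' * q n z')
    (T : ℕ → Z → Z → ℝ)
    (hT : ∀ n z z', T n z z' = α n z z' * q n z'
      + (if z' = z then (1:ℝ) else 0) * (1 - ν n z))
    (a : ℕ → ℝ)
    (habdd : ∀ n, 1 ≤ n → BddAbove (Set.range fun w => |gbar n w - gbar (n+1) w| / g₀ w))
    (ha : ∀ n, 1 ≤ n → a n = ⨆ w, |gbar n w - gbar (n+1) w| / g₀ w)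
    (C r : ℝ) (hC : 0 < C) (hr : 0 < r)
    (hdecay : ∀ n, 1 ≤ n → a n ≤ C * (n : ℝ) ^ (-r))
    (qI : Z → ℝ) (hqIpos : ∀ z, 0 < qI z) (hqIsum : HasSum qI 1)
    (hdomI : ∀ z, qI z ≤ K * g₀ z)
    (P : MeasureTheory.Measure (ℕ → Z)) [MeasureTheory.IsProbabilityMeasure P]
    (hcyl : ∀ n : ℕ, 1 ≤ n → ∀ f : ℕ → Z,
      P {ω | ∀ k, 1 ≤ k → k ≤ n → ω k = f k} =
        ENNReal.ofReal (qI (f 1) * ∏ k ∈ Finset.Ico 1 n, T k (f k) (f (k+1))))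
    (h : Z → ℝ) (hsq : Summable fun z => (h z) ^ 2 * g₀ z) :
    ∀ᵐ ω ∂P, Filter.Tendsto
      (fun n : ℕ => (1 / (n : ℝ)) * ∑ j ∈ Finset.Icc 1 n, h (ω j))
      Filter.atTop (nhds (∑' z, h z * π z)) := by
  set β : ℝ := ω₁ / K with hβ
  have hK0 : 0 < K := by linarith
  have hβ0 : 0 < β := div_pos hω₁pos hK0
  have hβ1 : β < 1 := (div_lt_one hK0).2 (by linarith)
  have hqpos : ∀ n, 1 ≤ n → ∀ z, 0 < q n z := fun n hn z => by
    rw [hq]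
    have := mul_nonneg (sub_nonneg.2 hω₁lt.le) (hgbarpos n hn z)
    linarith [mul_pos hω₁pos (hg₀pos z)]
  have hqsum : ∀ n, 1 ≤ n → HasSum (q n) 1 := fun n hn => by
    have := (hg₀sum.mul_left ω₁).add ((hgbarsum n hn).mul_left (1 - ω₁))
    rw [funext (hq n)]
    simpa using this
  have hqπ : ∀ n, 1 ≤ n → ∀ z, β * π z ≤ q n z := fun n hn z => by
    have h1 : β * π z ≤ ω₁ * g₀ z := by
      rw [hβ, div_mul_eq_mul_div, div_le_iff₀ hK0]
      nlinarith [hdomπ z]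
    rw [hq]
    linarith [mul_nonneg (sub_nonneg.2 hω₁lt.le) (hgbarpos n hn z)]
  have hqg : ∀ n, 1 ≤ n → ∀ z, q n z ≤ K * g₀ z := fun n hn z => by
    rw [hq]
    nlinarith [hdomgbar n hn z, hg₀pos z, mul_pos hω₁pos (hg₀pos z)]
  have hTM : ∀ n, T n = metropolisKernel π (q n) := fun n => by
    funext z z'
    rw [hT, hν, metropolisKernel]
    simp only [hα, acceptedFlow]
  have H : IsInhomogeneousChain (fun z => ENNReal.ofReal (qI z))
      (fun n z y => ENNReal.ofReal (metropolisKernel π (q n) z y)) P := fun n hn f => by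
    rw [hcyl n hn, ENNReal.ofReal_mul (hqIpos _).le, ENNReal.ofReal_prod_of_nonneg]
    · simp only [hTM]
    · intro k hk
      have hk1 := (Finset.mem_Ico.1 hk).1
      rw [hTM]
      exact (mul_nonneg hβ0.le (hπpos _).le).trans
        (mul_le_metropolisKernel hπpos (hqpos k hk1) (hqsum k hk1) (hqπ k hk1) _ _)
  exact ae_tendsto_average_of_forall_nonneg (X := fun j (ω : ℕ → Z) => ω j) hπpos hg₀pos
    hg₀sum.summable hdomπ (ae_tendsto_average_metropolisKernel hπpos hπsum hg₀pos
      hqpos hqsum hβ0 hβ1 hK0 hqπ hqg hdomπ hdomI H) h hsq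
end
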